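/- There is a constant C (depending only on b, c_+, c_- and the fixed cutoff functions) such that for all p∈(1,2] and all Schwartz functions f on ℝ², ‖𝓜_0 f‖_{L^p(ℝ²)} ≤ C (p-1)^{-2} ‖f‖_{L^p(ℝ²)}, where 𝓜_0 f(x)=sup_{j∈ℤ} sup_{u∈ℝ} |A_{j,0}^u f(x)|. -/

import Mathlib

open MeasureTheory Filter Set Topology
open scoped ENNReal NNReal Topology Classical

noncomputable section

/-- The homogeneous curve of degree `b`: `γ_b(t) = c₊ t^b` for `t > 0`,
`γ_b(t) = c₋ (-t)^b` for `t < 0`, `γ_b(0) = 0`. -/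
def curve (b cp cm t : ℝ) : ℝ :=
  if 0 < t then cp * t ^ b else if t < 0 then cm * (-t) ^ b else 0

/-- The maximal function along the curve `(t, u γ_b(t))`. -/
def Mu (b cp cm u : ℝ) (f : ℝ × ℝ → ℝ) (x : ℝ × ℝ) : ℝ :=
  ⨆ R : {R : ℝ // 0 < R},
    ((R : ℝ))⁻¹ * ∫ t in (0:ℝ)..(R : ℝ), |f (x - (t, u * curve b cp cm t))|

/-- The maximal function `𝓜^U f = sup_{u ∈ U} M^{(u)} f`. -/
def calM (b cp cm : ℝ) (U : Set ℝ) (f : ℝ × ℝ → ℝ) (x : ℝ × ℝ) : ℝ :=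
  ⨆ u : U, Mu b cp cm (u : ℝ) f x

/-- The Hilbert transform along the curve `(t, u γ_b(t))` (principal value). -/
def Hu (b cp cm u : ℝ) (f : ℝ × ℝ → ℝ) (x : ℝ × ℝ) : ℝ :=
  limUnder (𝓝[>] (0:ℝ)) fun ε : ℝ =>
    ∫ t in {t : ℝ | ε < |t| ∧ |t| < ε⁻¹}, f (x - (t, u * curve b cp cm t)) / t

/-- The maximal function `𝓗^U f = sup_{u ∈ U} |H^{(u)} f|`, valued in `ℝ≥0∞`. -/
def calH (b cp cm : ℝ) (U : Set ℝ) (f : ℝ × ℝ → ℝ) (x : ℝ × ℝ) : ℝ≥0∞ :=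
  ⨆ u : U, ENNReal.ofReal |Hu b cp cm (u : ℝ) f x|

/-- The `L^p` norm of an `ℝ≥0∞`-valued function on `ℝ²`. -/
def lpN (g : ℝ × ℝ → ℝ≥0∞) (p : ℝ) : ℝ≥0∞ :=
  (∫⁻ x : ℝ × ℝ, g x ^ p) ^ (1 / p)

def eN (p : ℝ) : ℝ≥0∞ := ENNReal.ofReal p

/-- `U^r = r⁻¹ U ∩ [1,2] = {ρ ∈ [1,2] : rρ ∈ U}`. -/
def UrSet (U : Set ℝ) (r : ℝ) : Set ℝ := {ρ : ℝ | ρ ∈ Icc (1:ℝ) 2 ∧ r * ρ ∈ U}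

/-- `N(A,δ)`: minimal number of intervals of length `δ` needed to cover `A`. -/
def covN (A : Set ℝ) (δ : ℝ) : ℕ :=
  sInf {n : ℕ | ∃ F : Finset ℝ, F.card = n ∧ A ⊆ ⋃ a ∈ F, Icc a (a + δ)}

/-- `𝒦_p(U,δ) = δ^{1-1/p} sup_{r>0} N(U^r,δ)^{1/p}`. -/
def Kp (U : Set ℝ) (δ p : ℝ) : ℝ :=
  δ ^ (1 - 1 / p) * ⨆ r : {r : ℝ // 0 < r}, ((covN (UrSet U (r : ℝ)) δ : ℝ)) ^ (1 / p)

/-- `p_cr(U) = 1 + limsup_{δ→0+} sup_{r>0} log N(U^r,δ) / log(1/δ)`. -/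
def pcr (U : Set ℝ) : ℝ :=
  1 + limsup (fun δ : ℝ =>
      (⨆ r : {r : ℝ // 0 < r}, Real.log (covN (UrSet U (r : ℝ)) δ)) / Real.log δ⁻¹)
    (𝓝[>] (0:ℝ))

/-- `𝔑(U) = 1 + #{n ∈ ℤ : [2ⁿ, 2ⁿ⁺¹] ∩ U ≠ ∅}`. -/
def frakN (U : Set ℝ) : ℕ∞ :=
  1 + Set.encard {n : ℤ | (Icc ((2:ℝ) ^ n) ((2:ℝ) ^ (n + 1)) ∩ U).Nonempty}

/-- `√(log 𝔑(U))`, valued in `ℝ≥0∞` (equal to `∞` if `𝔑(U) = ∞`). -/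
def sqrtLogN (U : Set ℝ) : ℝ≥0∞ :=
  if frakN U = ⊤ then ⊤
  else ENNReal.ofReal (Real.sqrt (Real.log ((frakN U).toNat : ℝ)))

/-- The `L^p → L^p` operator norm of `𝓜^U` (smallest admissible constant, possibly `∞`). -/
def opNormM (b cp cm : ℝ) (U : Set ℝ) (p : ℝ) : ℝ≥0∞ :=
  sInf {C : ℝ≥0∞ | ∀ f : SchwartzMap (ℝ × ℝ) ℝ,
    eLpNorm (calM b cp cm U ⇑f) (eN p) volume ≤ C * eLpNorm ⇑f (eN p) volume}

/-- The `L^p → L^p` operator norm of `𝓗^U` (smallest admissible constant, possibly `∞`). -/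
def opNormH (b cp cm : ℝ) (U : Set ℝ) (p : ℝ) : ℝ≥0∞ :=
  sInf {C : ℝ≥0∞ | ∀ f : SchwartzMap (ℝ × ℝ) ℝ,
    lpN (calH b cp cm U ⇑f) p ≤ C * eLpNorm ⇑f (eN p) volume}

/-- `θ_{p,ℓ}`. -/
def theta (p : ℝ) (l : ℕ) : ℝ :=
  if (l : ℝ) ≤ (p - 1)⁻¹ then (p - 1) ^ (3 - 10 / p) else (l : ℝ) ^ (7 * (2 / p - 1))

/-- `Σ_{ℓ≥1} θ_{p,ℓ} 𝒦_p(U, 2^{-ℓ})`, valued in `ℝ≥0∞`. -/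
def KpSum (U : Set ℝ) (p : ℝ) : ℝ≥0∞ :=
  ∑' l : ℕ, ENNReal.ofReal (theta p (l + 1) * Kp U ((2:ℝ) ^ (-((l : ℝ) + 1))) p)

/-- The Fourier transform on `ℝ²`. -/
def FT (f : ℝ × ℝ → ℂ) (ξ : ℝ × ℝ) : ℂ :=
  ∫ x : ℝ × ℝ,
    Complex.exp ((((-(2 * Real.pi * (x.1 * ξ.1 + x.2 * ξ.2))) : ℝ) : ℂ) * Complex.I) * f x

/-- The inverse Fourier transform on `ℝ²`. -/
def FTinv (g : ℝ × ℝ → ℂ) (x : ℝ × ℝ) : ℂ :=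
  ∫ ξ : ℝ × ℝ,
    Complex.exp (((2 * Real.pi * (x.1 * ξ.1 + x.2 * ξ.2) : ℝ) : ℂ) * Complex.I) * g ξ

/-- `τ̂₀(ξ) = ∫ e^{-2πi(ξ₁t + ξ₂γ_b(t))} χ₊(t) dt`. -/
def tauHat (b cp cm : ℝ) (χp : ℝ → ℝ) (ξ : ℝ × ℝ) : ℂ :=
  ∫ t : ℝ,
    Complex.exp ((((-(2 * Real.pi * (ξ.1 * t + ξ.2 * curve b cp cm t))) : ℝ) : ℂ) * Complex.I)
      * ((χp t : ℝ) : ℂ)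

/-- `σ̂(ξ) = ∫ e^{-2πi(ξ₁t + ξ₂γ_b(t))} χ(t) dt/t` for a cutoff `χ`. -/
def sigmaHat (b cp cm : ℝ) (χ : ℝ → ℝ) (ξ : ℝ × ℝ) : ℂ :=
  ∫ t : ℝ,
    Complex.exp ((((-(2 * Real.pi * (ξ.1 * t + ξ.2 * curve b cp cm t))) : ℝ) : ℂ) * Complex.I)
      * ((χ t / t : ℝ) : ℂ)

/-- `ρ̂₀(ξ) = (1-η₀(ξ)) ς₋(ξ₁/(c₊ξ₂)) τ̂₀(ξ)`. -/
def rhoHat (b cp cm : ℝ) (χp : ℝ → ℝ) (η : ℝ × ℝ → ℝ) (ςm : ℝ → ℝ) (ξ : ℝ × ℝ) : ℂ :=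
  (((1 - η ξ) * ςm (ξ.1 / (cp * ξ.2)) : ℝ) : ℂ) * tauHat b cp cm χp ξ

/-- `μ̂_{0,±}`; `sgn = true` is the `+` sign. -/
def muHat (b cp cm : ℝ) (χp : ℝ → ℝ) (η : ℝ × ℝ → ℝ) (ςp ςm : ℝ → ℝ) (sgn : Bool)
    (ξ : ℝ × ℝ) : ℂ :=
  if sgn then
    (((1 - η ξ) * ςm (ξ.1 / (cp * ξ.2)) : ℝ) : ℂ) * sigmaHat b cp cm χp ξ
  else
    (((1 - η ξ) * ςp (ξ.1 / (cm * ξ.2)) : ℝ) : ℂ) * sigmaHat b cp cm (fun t => χp (-t)) ξ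

/-- `ζ_ℓ(ξ) = ζ₀(2^{-ℓ}ξ) - ζ₀(2^{1-ℓ}ξ)`. -/
def zl (ζ : ℝ × ℝ → ℝ) (l : ℕ) (ξ : ℝ × ℝ) : ℝ :=
  ζ ((2:ℝ) ^ (-(l : ℝ)) • ξ) - ζ ((2:ℝ) ^ (1 - (l : ℝ)) • ξ)

/-- The anisotropic dilation `ξ ↦ (2^{-j}ξ₁, 2^{-jb} u ξ₂)`. -/
def dil (b : ℝ) (j : ℤ) (u : ℝ) (ξ : ℝ × ℝ) : ℝ × ℝ :=
  ((2:ℝ) ^ (-(j : ℝ)) * ξ.1, (2:ℝ) ^ (-((j : ℝ) * b)) * (u * ξ.2))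

/-- `A_{j,ℓ}^u`, defined via `(A_{j,ℓ}^u f)^(ξ) = ζ_ℓ(...) ρ̂₀(...) f̂(ξ)`. -/
def Ajl (b cp cm : ℝ) (χp : ℝ → ℝ) (η : ℝ × ℝ → ℝ) (ςm : ℝ → ℝ) (ζ : ℝ × ℝ → ℝ)
    (j : ℤ) (l : ℕ) (u : ℝ) (f : ℝ × ℝ → ℝ) : ℝ × ℝ → ℂ :=
  FTinv fun ξ =>
    ((zl ζ l (dil b j u ξ) : ℝ) : ℂ) * rhoHat b cp cm χp η ςm (dil b j u ξ)
      * FT (fun x => ((f x : ℝ) : ℂ)) ξ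

/-- `T_{j,ℓ,±}^u`, defined via `(T_{j,ℓ,±}^u f)^(ξ) = ζ_ℓ(...) μ̂_{0,±}(...) f̂(ξ)`. -/
def Tjl (b cp cm : ℝ) (χp : ℝ → ℝ) (η : ℝ × ℝ → ℝ) (ςp ςm : ℝ → ℝ) (ζ : ℝ × ℝ → ℝ)
    (sgn : Bool) (j : ℤ) (l : ℕ) (u : ℝ) (f : ℝ × ℝ → ℝ) : ℝ × ℝ → ℂ :=
  FTinv fun ξ =>
    ((zl ζ l (dil b j u ξ) : ℝ) : ℂ) * muHat b cp cm χp η ςp ςm sgn (dil b j u ξ)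
      * FT (fun x => ((f x : ℝ) : ℂ)) ξ

/-- `φ̂₀(ξ) = η₀(ξ)τ̂₀(ξ) + (1-η₀(ξ))(1-ς₋(ξ₁/(c₊ξ₂)))τ̂₀(ξ)` (maximal-function version). -/
def phiHatTau (b cp cm : ℝ) (χp : ℝ → ℝ) (η : ℝ × ℝ → ℝ) (ςm : ℝ → ℝ) (ξ : ℝ × ℝ) : ℂ :=
  ((η ξ + (1 - η ξ) * (1 - ςm (ξ.1 / (cp * ξ.2))) : ℝ) : ℂ) * tauHat b cp cm χp ξ

/-- `A_{j,0}^u`, defined via `(A_{j,0}^u f)^(ξ) = φ̂₀(2^{-j}ξ₁, 2^{-jb}uξ₂) f̂(ξ)`. -/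
def Aj0 (b cp cm : ℝ) (χp : ℝ → ℝ) (η : ℝ × ℝ → ℝ) (ςm : ℝ → ℝ)
    (j : ℤ) (u : ℝ) (f : ℝ × ℝ → ℝ) : ℝ × ℝ → ℂ :=
  FTinv fun ξ => phiHatTau b cp cm χp η ςm (dil b j u ξ) * FT (fun x => ((f x : ℝ) : ℂ)) ξ

/-- `φ̂₀(ξ)` (Hilbert-transform version, built from `σ̂_±`). -/
def phiHatSigma (b cp cm : ℝ) (χp : ℝ → ℝ) (η : ℝ × ℝ → ℝ) (ςp ςm : ℝ → ℝ)
    (ξ : ℝ × ℝ) : ℂ :=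
  ((η ξ : ℝ) : ℂ) * (sigmaHat b cp cm χp ξ + sigmaHat b cp cm (fun t => χp (-t)) ξ)
    + (((1 - η ξ) * (1 - ςm (ξ.1 / (cp * ξ.2))) : ℝ) : ℂ) * sigmaHat b cp cm χp ξ
    + (((1 - η ξ) * (1 - ςp (ξ.1 / (cm * ξ.2))) : ℝ) : ℂ)
        * sigmaHat b cp cm (fun t => χp (-t)) ξ

/-- `S^{(u)}`, defined via `(S^{(u)} f)^(ξ) = Σ_j φ̂₀(2^{-j}ξ₁, 2^{-jb}uξ₂) f̂(ξ)`. -/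
def Sop (b cp cm : ℝ) (χp : ℝ → ℝ) (η : ℝ × ℝ → ℝ) (ςp ςm : ℝ → ℝ)
    (u : ℝ) (f : ℝ × ℝ → ℝ) : ℝ × ℝ → ℂ :=
  FTinv fun ξ =>
    (∑' j : ℤ, phiHatSigma b cp cm χp η ςp ςm (dil b j u ξ)) * FT (fun x => ((f x : ℝ) : ℂ)) ξ

/-- The convolution `τ_j^u * f`. -/
def tauConv (b cp cm : ℝ) (χp : ℝ → ℝ) (j : ℤ) (u : ℝ) (f : ℝ × ℝ → ℝ) (x : ℝ × ℝ) : ℝ :=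
  ∫ t : ℝ, f (x - (t, u * curve b cp cm t)) * ((2:ℝ) ^ j * χp ((2:ℝ) ^ j * t))

/-- The `ℓ^p(ℕ)` norm of a sequence. -/
def wNorm (w : ℕ → ℂ) (p : ℝ) : ℝ≥0∞ :=
  (∑' i : ℕ, ENNReal.ofReal (‖w i‖ ^ p)) ^ (1 / p)

/-- The auxiliary maximal operator `𝔐_R[f,w]`. -/
def MfrakR (b cp cm : ℝ) (χp : ℝ → ℝ) (s : ℤ → ℕ → ℝ) (R : ℕ)
    (f : ℝ × ℝ → ℝ) (w : ℤ → ℕ → ℂ) (x : ℝ × ℝ) : ℝ≥0∞ :=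
  ⨆ (j : ℤ) (_ : -(R:ℤ) ≤ j ∧ j ≤ R) (n : ℤ) (_ : -(R:ℤ) ≤ n ∧ n ≤ R) (i : ℕ),
    ENNReal.ofReal
      (‖w n i‖ * |tauConv b cp cm χp j ((2:ℝ) ^ (b * (n : ℝ)) * s n i) f x|)

/-- `B_p(R)`: the best constant in `‖𝔐_R[f,w]‖_p ≤ C (sup_n ‖w_n‖_{ℓ^p}) ‖f‖_p`. -/
def BpR (b cp cm : ℝ) (χp : ℝ → ℝ) (s : ℤ → ℕ → ℝ) (p : ℝ) (R : ℕ) : ℝ≥0∞ :=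
  ⨆ (f : SchwartzMap (ℝ × ℝ) ℝ) (w : ℤ → ℕ → ℂ)
    (_ : eLpNorm ⇑f (eN p) volume ≤ 1) (_ : ∀ n : ℤ, wNorm (w n) p ≤ 1),
    lpN (MfrakR b cp cm χp s R ⇑f w) p

/-- `ℓ^q` norm (over an index type) of an `ℝ≥0∞`-valued family, `q ∈ (0,∞]`. -/
def lqS {ι : Type*} (q : ℝ≥0∞) (g : ι → ℝ≥0∞) : ℝ≥0∞ :=
  if q = ⊤ then ⨆ i, g i else (∑' i, g i ^ q.toReal) ^ (1 / q.toReal)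

/-- The quotient `p/q`, with the convention `p/∞ = 0`. -/
def pqr (p : ℝ) (q : ℝ≥0∞) : ℝ := if q = ⊤ then 0 else p / q.toReal

/-- The dyadic-radius centered maximal function on the real line. -/
def avgMax (g : ℝ → ℝ≥0∞) (x : ℝ) : ℝ≥0∞ :=
  ⨆ k : ℤ, (ENNReal.ofReal (2 * (2:ℝ) ^ k))⁻¹ * ∫⁻ t in Metric.closedBall x ((2:ℝ) ^ k), g t

lemma measurable_avgMax {g : ℝ → ℝ≥0∞} (hg : Measurable g) : Measurable (avgMax g) := by
  refine Measurable.iSup fun k => Measurable.const_mul ?_ _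
  have h : (fun x : ℝ => ∫⁻ t in Metric.closedBall x ((2:ℝ) ^ k), g t)
      = fun x => ∫⁻ t, ({q : ℝ × ℝ | dist q.2 q.1 ≤ (2:ℝ) ^ k}.indicator (fun q => g q.2)) (x, t) := by
    funext x
    rw [← lintegral_indicator Metric.isClosed_closedBall.measurableSet]
    rfl
  rw [h]
  refine Measurable.lintegral_prod_right' ?_
  refine (hg.comp measurable_snd).indicator ?_
  exact measurableSet_le (measurable_snd.dist measurable_fst) measurable_const

lemma measure_lt_avgMax_le (g : ℝ → ℝ≥0∞) {l : ℝ≥0∞} (hl : l ≠ 0) (hl' : l ≠ ⊤) :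
    volume {x | l < avgMax g x} * l ≤ 4 * ∫⁻ t, g t := by
  by_cases hfin : ∫⁻ t, g t = ⊤
  · simp [hfin, ENNReal.mul_top]
  set T : Set (ℝ × ℤ) := {a | l * ENNReal.ofReal (2 * (2:ℝ) ^ a.2)
    < ∫⁻ t in Metric.closedBall a.1 ((2:ℝ) ^ a.2), g t} with hT
  set R : ℝ := (∫⁻ t, g t).toReal / l.toReal with hR
  have hlpos : 0 < l.toReal := ENNReal.toReal_pos hl hl'
  have hrad : ∀ a ∈ T, (2:ℝ) ^ a.2 ≤ R := by
    intro a ha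
    have h1 : l * ENNReal.ofReal (2 * (2:ℝ) ^ a.2) ≤ ∫⁻ t, g t :=
      (le_of_lt ha).trans (setLIntegral_le_lintegral _ _)
    have h2 := ENNReal.toReal_mono hfin h1
    have h3 : (0:ℝ) < 2 ^ a.2 := by positivity
    rw [ENNReal.toReal_mul, ENNReal.toReal_ofReal (by positivity)] at h2
    rw [hR, le_div_iff₀ hlpos]
    nlinarith
  obtain ⟨u, huT, hdisj, hcov⟩ := Vitali.exists_disjoint_subfamily_covering_enlargement_closedBall
    T (fun a => a.1) (fun a => (2:ℝ) ^ a.2) R hrad 4 (by norm_num)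
  have hcount : u.Countable := by
    refine hdisj.countable_of_nonempty_interior fun a _ => ?_
    refine ⟨a.1, Metric.ball_subset_interior_closedBall (Metric.mem_ball_self (by positivity))⟩
  have hsub : {x | l < avgMax g x} ⊆ ⋃ a ∈ u, Metric.closedBall a.1 (4 * (2:ℝ) ^ a.2) := by
    intro x hx
    obtain ⟨k, hk⟩ := lt_iSup_iff.1 (show l < avgMax g x from hx)
    have hmem : (x, k) ∈ T := by
      show l * ENNReal.ofReal (2 * (2:ℝ) ^ k) < ∫⁻ t in Metric.closedBall x ((2:ℝ) ^ k), g t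
      rw [mul_comm, ← div_eq_mul_inv] at hk
      exact (ENNReal.lt_div_iff_mul_lt (Or.inl (by simp; positivity))
        (Or.inl ENNReal.ofReal_ne_top)).1 hk
    obtain ⟨b, hb, hsubb⟩ := hcov _ hmem
    exact mem_biUnion hb (hsubb (Metric.mem_closedBall_self (by positivity)))
  have := hcount.to_subtype
  calc volume {x | l < avgMax g x} * l
      ≤ (∑' a : u, volume (Metric.closedBall a.1.1 (4 * (2:ℝ) ^ a.1.2))) * l := by
        gcongr
        exact (measure_mono hsub).trans (measure_biUnion_le _ hcount _)
    _ = ∑' a : u, 4 * (l * ENNReal.ofReal (2 * (2:ℝ) ^ a.1.2)) := by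
        rw [← ENNReal.tsum_mul_right]
        refine tsum_congr fun a => ?_
        rw [Real.volume_closedBall, show 2 * (4 * (2:ℝ) ^ a.1.2) = 4 * (2 * (2:ℝ) ^ a.1.2) by ring,
          ENNReal.ofReal_mul (by norm_num)]
        simp only [ENNReal.ofReal_ofNat]
        ring
    _ ≤ ∑' a : u, 4 * ∫⁻ t in Metric.closedBall a.1.1 ((2:ℝ) ^ a.1.2), g t := by
        refine ENNReal.tsum_le_tsum fun a => ?_
        gcongr
        exact le_of_lt (huT a.2)
    _ = 4 * ∫⁻ t in ⋃ a ∈ u, Metric.closedBall a.1 ((2:ℝ) ^ a.2), g t := by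
        rw [ENNReal.tsum_mul_left, lintegral_biUnion hcount
          (fun a _ => Metric.isClosed_closedBall.measurableSet) hdisj]
    _ ≤ 4 * ∫⁻ t, g t := by
        exact mul_le_mul_right (setLIntegral_le_lintegral _ _) _

lemma avgMax_le_add {g h : ℝ → ℝ≥0∞} {c : ℝ≥0∞} (hgh : ∀ t, g t ≤ h t + c) (x : ℝ) :
    avgMax g x ≤ avgMax h x + c := by
  refine iSup_le fun k => ?_
  have h0 : ENNReal.ofReal (2 * (2:ℝ) ^ k) ≠ 0 := by simp; positivity
  calc (ENNReal.ofReal (2 * (2:ℝ) ^ k))⁻¹ * ∫⁻ t in Metric.closedBall x ((2:ℝ) ^ k), g t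
      ≤ (ENNReal.ofReal (2 * (2:ℝ) ^ k))⁻¹
          * ∫⁻ t in Metric.closedBall x ((2:ℝ) ^ k), (h t + c) := by
        gcongr with t
        exact hgh t
    _ = (ENNReal.ofReal (2 * (2:ℝ) ^ k))⁻¹ * (∫⁻ t in Metric.closedBall x ((2:ℝ) ^ k), h t) + c := by
        rw [lintegral_add_right _ measurable_const, mul_add, setLIntegral_const,
          Real.volume_closedBall, mul_comm c, ← mul_assoc,
          ENNReal.inv_mul_cancel h0 ENNReal.ofReal_ne_top, one_mul]
    _ ≤ avgMax h x + c := by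
        gcongr
        exact le_iSup (fun k : ℤ => (ENNReal.ofReal (2 * (2:ℝ) ^ k))⁻¹
          * ∫⁻ t in Metric.closedBall x ((2:ℝ) ^ k), h t) k

lemma avgMax_le_const {g : ℝ → ℝ≥0∞} {c : ℝ≥0∞} (hg : ∀ t, g t ≤ c) (x : ℝ) :
    avgMax g x ≤ c := by
  have h := avgMax_le_add (g := g) (h := fun _ => 0) (c := c) (by simpa using hg) x
  simpa [avgMax] using h

lemma measure_lt_avgMax_le_setLIntegral {g : ℝ → ℝ≥0∞} (hg : Measurable g) {l : ℝ}
    (hl : 0 < l) :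
    volume {x | ENNReal.ofReal l < avgMax g x}
      ≤ ENNReal.ofReal (8 / l) * ∫⁻ t in {t | ENNReal.ofReal (l / 2) < g t}, g t := by
  set S : Set ℝ := {t | ENNReal.ofReal (l / 2) < g t} with hS
  have hSm : MeasurableSet S := measurableSet_lt measurable_const hg
  have hsub : {x | ENNReal.ofReal l < avgMax g x}
      ⊆ {x | ENNReal.ofReal (l / 2) < avgMax (S.indicator g) x} := by
    intro x hx
    have h1 : avgMax g x ≤ avgMax (S.indicator g) x + ENNReal.ofReal (l / 2) := by
      refine avgMax_le_add (fun t => ?_) x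
      by_cases ht : t ∈ S
      · simp [ht]
      · simp only [ht, not_false_eq_true, indicator_of_notMem, zero_add]
        exact not_lt.1 ht
    have h2 : ENNReal.ofReal (l / 2) + ENNReal.ofReal (l / 2)
        < avgMax (S.indicator g) x + ENNReal.ofReal (l / 2) := by
      rw [← ENNReal.ofReal_add (by positivity) (by positivity), add_halves]
      exact lt_of_lt_of_le hx h1
    exact lt_of_add_lt_add_right h2
  have hw := measure_lt_avgMax_le (S.indicator g) (l := ENNReal.ofReal (l / 2))
    (by simp; positivity) ENNReal.ofReal_ne_top
  rw [lintegral_indicator hSm] at hw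
  have hc : ENNReal.ofReal (8 / l) = 4 / ENNReal.ofReal (l / 2) := by
    rw [show (4 : ℝ≥0∞) = ENNReal.ofReal 4 by simp, ← ENNReal.ofReal_div_of_pos (by positivity)]
    congr 1
    field_simp
    norm_num
  rw [hc, ENNReal.div_eq_inv_mul, mul_assoc, mul_comm, ← div_eq_mul_inv]
  rw [ENNReal.le_div_iff_mul_le (Or.inl (by simp; positivity)) (Or.inl ENNReal.ofReal_ne_top)]
  exact (mul_le_mul_left (measure_mono hsub) _).trans hw

lemma lintegral_avgMax_rpow_le {g : ℝ → ℝ≥0∞} (hg : Measurable g) {B : ℝ≥0∞} (hB : B ≠ ⊤)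
    (hgB : ∀ t, g t ≤ B) {p : ℝ} (hp : 1 < p) (hp2 : p ≤ 2) :
    ∫⁻ x, avgMax g x ^ p ≤ ENNReal.ofReal (32 / (p - 1)) * ∫⁻ x, g x ^ p := by
  have hp0 : 0 < p - 1 := by linarith
  have hgfin : ∀ t, g t ≠ ⊤ := fun t => ne_top_of_le_ne_top hB (hgB t)
  have hAfin : ∀ x, avgMax g x ≠ ⊤ := fun x => ne_top_of_le_ne_top hB (avgMax_le_const hgB x)
  have hlay := lintegral_rpow_eq_lintegral_meas_lt_mul (μ := (volume : Measure ℝ))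
    (f := fun x => (avgMax g x).toReal) (p := p) (ae_of_all _ fun x => ENNReal.toReal_nonneg)
    (measurable_avgMax hg).ennreal_toReal.aemeasurable (by linarith)
  have hL : ∫⁻ x, avgMax g x ^ p = ∫⁻ x, ENNReal.ofReal ((avgMax g x).toReal ^ p) := by
    refine lintegral_congr fun x => ?_
    rw [← ENNReal.ofReal_rpow_of_nonneg ENNReal.toReal_nonneg (by linarith),
      ENNReal.ofReal_toReal (hAfin x)]
  have hkey : ∀ t ∈ Ioi (0:ℝ), volume {a | t < (avgMax g a).toReal} * ENNReal.ofReal (t ^ (p - 1))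
      ≤ ∫⁻ s, {q : ℝ × ℝ | q.1 < 2 * (g q.2).toReal}.indicator
          (fun q => ENNReal.ofReal (8 * q.1 ^ (p - 2)) * g q.2) (t, s) := by
    intro t ht
    have ht : 0 < t := ht
    have hset : {a | t < (avgMax g a).toReal} = {a | ENNReal.ofReal t < avgMax g a} := by
      ext a
      exact (ENNReal.ofReal_lt_iff_lt_toReal ht.le (hAfin a)).symm
    have hset2 : {s | ENNReal.ofReal (t / 2) < g s} = {s | t < 2 * (g s).toReal} := by
      ext s
      change ENNReal.ofReal (t / 2) < g s ↔ t < 2 * (g s).toReal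
      rw [ENNReal.ofReal_lt_iff_lt_toReal (by positivity) (hgfin s)]
      constructor <;> intro h <;> linarith
    have hm : MeasurableSet {s | t < 2 * (g s).toReal} :=
      measurableSet_lt measurable_const (hg.ennreal_toReal.const_mul 2)
    rw [hset]
    calc volume {a | ENNReal.ofReal t < avgMax g a} * ENNReal.ofReal (t ^ (p - 1))
        ≤ (ENNReal.ofReal (8 / t) * ∫⁻ s in {s | ENNReal.ofReal (t / 2) < g s}, g s)
            * ENNReal.ofReal (t ^ (p - 1)) := by
          gcongr
          exact measure_lt_avgMax_le_setLIntegral hg ht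
      _ = ENNReal.ofReal (8 * t ^ (p - 2)) * ∫⁻ s in {s | t < 2 * (g s).toReal}, g s := by
          rw [mul_right_comm, ← ENNReal.ofReal_mul (by positivity), hset2]
          congr 2
          rw [show p - 2 = p - 1 - 1 by ring, Real.rpow_sub_one ht.ne' (p - 1)]
          ring
      _ = ∫⁻ s, {q : ℝ × ℝ | q.1 < 2 * (g q.2).toReal}.indicator
          (fun q => ENNReal.ofReal (8 * q.1 ^ (p - 2)) * g q.2) (t, s) := by
          rw [← lintegral_const_mul _ hg, ← lintegral_indicator hm]
          rfl
  have hinner : ∀ y : ℝ, 0 ≤ y → ∫⁻ t in Ioi (0:ℝ), (Iio (2 * y)).indicator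
      (fun t => ENNReal.ofReal (8 * t ^ (p - 2))) t
      = ENNReal.ofReal (8 * ((2 * y) ^ (p - 1) / (p - 1))) := by
    intro y hy
    rw [lintegral_indicator measurableSet_Iio, Measure.restrict_restrict measurableSet_Iio,
      Iio_inter_Ioi, restrict_Ioo_eq_restrict_Ioc]
    have hInt := intervalIntegral.intervalIntegrable_rpow' (a := 0) (b := 2 * y) (r := p - 2)
      (by linarith)
    rw [intervalIntegrable_iff_integrableOn_Ioc_of_le (by positivity)] at hInt
    rw [← ofReal_integral_eq_lintegral_ofReal (hInt.const_mul 8)]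
    · rw [← intervalIntegral.integral_of_le (by positivity), intervalIntegral.integral_const_mul,
        integral_rpow (Or.inl (by linarith)), show p - 2 + 1 = p - 1 by ring,
        Real.zero_rpow hp0.ne', sub_zero]
    · filter_upwards [ae_restrict_mem measurableSet_Ioc] with t ht
      have := ht.1
      positivity
  have hmeas : Measurable ({q : ℝ × ℝ | q.1 < 2 * (g q.2).toReal}.indicator
          (fun q => ENNReal.ofReal (8 * q.1 ^ (p - 2)) * g q.2)) := by
    refine Measurable.indicator ?_ (measurableSet_lt measurable_fst
      ((hg.comp measurable_snd).ennreal_toReal.const_mul 2))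
    exact ((measurable_fst.pow_const _).const_mul 8).ennreal_ofReal.mul (hg.comp measurable_snd)
  rw [hL, hlay]
  calc ENNReal.ofReal p * ∫⁻ t in Ioi (0:ℝ), volume {a | t < (avgMax g a).toReal}
        * ENNReal.ofReal (t ^ (p - 1))
      ≤ ENNReal.ofReal p * ∫⁻ t in Ioi (0:ℝ), ∫⁻ s,
          {q : ℝ × ℝ | q.1 < 2 * (g q.2).toReal}.indicator
          (fun q => ENNReal.ofReal (8 * q.1 ^ (p - 2)) * g q.2) (t, s) := by
        exact mul_le_mul_right (setLIntegral_mono' measurableSet_Ioi hkey) _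
    _ = ENNReal.ofReal p * ∫⁻ s, ∫⁻ t in Ioi (0:ℝ),
          {q : ℝ × ℝ | q.1 < 2 * (g q.2).toReal}.indicator
          (fun q => ENNReal.ofReal (8 * q.1 ^ (p - 2)) * g q.2) (t, s) := by
        rw [lintegral_lintegral_swap]
        exact hmeas.aemeasurable
    _ = ENNReal.ofReal p * ∫⁻ s, ENNReal.ofReal (8 * ((2 * (g s).toReal) ^ (p - 1) / (p - 1)))
          * g s := by
        congr 1
        refine lintegral_congr fun s => ?_
        rw [← hinner _ ENNReal.toReal_nonneg, ← lintegral_mul_const]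
        · refine lintegral_congr fun t => ?_
          by_cases h : t < 2 * (g s).toReal <;> simp [indicator, h]
        · exact Measurable.indicator
            ((measurable_id.pow_const _).const_mul 8).ennreal_ofReal measurableSet_Iio
    _ ≤ ENNReal.ofReal p * ∫⁻ s, ENNReal.ofReal (16 / (p - 1)) * g s ^ p := by
        refine mul_le_mul_right (lintegral_mono fun s => ?_) _
        have h2 : (2:ℝ) ^ (p - 1) ≤ 2 := by
          calc (2:ℝ) ^ (p - 1) ≤ 2 ^ (1:ℝ) :=
                Real.rpow_le_rpow_of_exponent_le (by norm_num) (by linarith)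
            _ = 2 := Real.rpow_one 2
        set y := (g s).toReal with hy
        have hy0 : 0 ≤ y := ENNReal.toReal_nonneg
        have hgs : g s = ENNReal.ofReal y := (ENNReal.ofReal_toReal (hgfin s)).symm
        rw [hgs, ENNReal.ofReal_rpow_of_nonneg hy0 (by linarith),
          ← ENNReal.ofReal_mul (by positivity), ← ENNReal.ofReal_mul (by positivity)]
        refine ENNReal.ofReal_le_ofReal ?_
        rcases hy0.eq_or_lt with h | h
        · rw [← h]; simp; positivity
        rw [Real.mul_rpow (by norm_num) hy0]
        have h3 : y ^ p = y ^ (p - 1) * y := by rw [Real.rpow_sub_one h.ne']; field_simp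
        rw [h3]
        have h4 : 0 ≤ y ^ (p - 1) * y / (p - 1) := by positivity
        calc 8 * (2 ^ (p - 1) * y ^ (p - 1) / (p - 1)) * y
            = 2 ^ (p - 1) * (8 * (y ^ (p - 1) * y / (p - 1))) := by ring
          _ ≤ 2 * (8 * (y ^ (p - 1) * y / (p - 1))) := by gcongr
          _ = 16 / (p - 1) * (y ^ (p - 1) * y) := by ring
    _ = ENNReal.ofReal (p * (16 / (p - 1))) * ∫⁻ s, g s ^ p := by
        rw [lintegral_const_mul _ (hg.pow_const p), ← mul_assoc, ← ENNReal.ofReal_mul (by linarith)]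
    _ ≤ ENNReal.ofReal (32 / (p - 1)) * ∫⁻ x, g x ^ p := by
        gcongr
        rw [mul_div_assoc']
        gcongr
        linarith

/-- The (unnormalised) Poisson kernel `r / (r² + t²)`. -/
def poisKer (r t : ℝ) : ℝ := r / (r ^ 2 + t ^ 2)

lemma poisKer_nonneg {r : ℝ} (hr : 0 ≤ r) (t : ℝ) : 0 ≤ poisKer r t := by
  unfold poisKer; positivity

lemma measurable_poisKer (r : ℝ) : Measurable (poisKer r) := by
  unfold poisKer; fun_prop

/-- The maximal function over Poisson averages at dyadic scales. -/
def poisMax (g : ℝ → ℝ≥0∞) (x : ℝ) : ℝ≥0∞ :=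
  ⨆ k : ℤ, ∫⁻ t, ENNReal.ofReal (poisKer ((2:ℝ) ^ k) t) * g (x - t)

lemma exists_poisKer_le (k : ℤ) (t : ℝ) : ∃ i : ℕ, t ∈ Metric.closedBall (0:ℝ) ((2:ℝ) ^ (k + i)) ∧
    poisKer ((2:ℝ) ^ k) t ≤ 8 * (1 / 2) ^ i * (2 * (2:ℝ) ^ (k + i))⁻¹ := by
  have hex : ∃ i : ℕ, |t| ≤ (2:ℝ) ^ (k + i) := by
    obtain ⟨i, hi⟩ := pow_unbounded_of_one_lt (|t| / (2:ℝ) ^ k) (one_lt_two)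
    refine ⟨i, ?_⟩
    rw [div_lt_iff₀ (by positivity)] at hi
    rw [zpow_add₀ two_ne_zero, zpow_natCast]
    linarith
  have hk : (0:ℝ) < 2 ^ k := by positivity
  refine ⟨Nat.find hex, ?_, ?_⟩
  · rw [mem_closedBall_zero_iff, Real.norm_eq_abs]
    exact Nat.find_spec hex
  · rcases h : Nat.find hex with _ | i
    · unfold poisKer
      simp only [pow_zero, Nat.cast_zero, add_zero]
      rw [div_le_iff₀ (by positivity)]
      have : (8:ℝ) * 1 * (2 * (2:ℝ) ^ k)⁻¹ * (((2:ℝ) ^ k) ^ 2 + t ^ 2)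
        = 4 * 2 ^ k + 4 * t ^ 2 / 2 ^ k := by field_simp; ring
      rw [this]
      have : 0 ≤ 4 * t ^ 2 / (2:ℝ) ^ k := by positivity
      linarith
    · have hlt : (2:ℝ) ^ (k + i) < |t| := not_le.1 (Nat.find_min hex (m := i) (by omega))
      have hi : (0:ℝ) < 2 ^ i := by positivity
      rw [zpow_add₀ two_ne_zero, zpow_natCast] at hlt ⊢
      have hsq : ((2:ℝ) ^ k * 2 ^ i) ^ 2 ≤ t ^ 2 := by
        rw [← sq_abs t]; gcongr
      unfold poisKer
      rw [div_le_iff₀ (by positivity)]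
      have : (8:ℝ) * (1 / 2) ^ (i + 1) * (2 * ((2:ℝ) ^ k * 2 ^ (i + 1)))⁻¹
          * (((2:ℝ) ^ k) ^ 2 + t ^ 2) = (((2:ℝ) ^ k) ^ 2 + t ^ 2) / (2 ^ k * (2 ^ i) ^ 2) := by
        rw [one_div, inv_pow]
        field_simp
        ring
      rw [this, le_div_iff₀ (by positivity)]
      nlinarith [sq_nonneg ((2:ℝ) ^ k)]

lemma poisMax_le (g : ℝ → ℝ≥0∞) (hg : Measurable g) (x : ℝ) :
    poisMax g x ≤ 16 * avgMax g x := by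
  refine iSup_le fun k => ?_
  have hball : ∀ i : ℕ, ∫⁻ t, (Metric.closedBall (0:ℝ) ((2:ℝ) ^ (k + i))).indicator
      (fun t => g (x - t)) t = ∫⁻ t in Metric.closedBall x ((2:ℝ) ^ (k + i)), g t := by
    intro i
    rw [← lintegral_indicator Metric.isClosed_closedBall.measurableSet,
      ← lintegral_sub_left_eq_self _ x]
    refine lintegral_congr fun t => ?_
    simp only [indicator, Metric.mem_closedBall, Real.dist_eq]
    simp [abs_sub_comm x t]
  calc ∫⁻ t, ENNReal.ofReal (poisKer ((2:ℝ) ^ k) t) * g (x - t)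
      ≤ ∫⁻ t, ∑' i : ℕ, ENNReal.ofReal (8 * (1 / 2) ^ i * (2 * (2:ℝ) ^ (k + i))⁻¹) *
          (Metric.closedBall (0:ℝ) ((2:ℝ) ^ (k + i))).indicator (fun t => g (x - t)) t := by
        refine lintegral_mono fun t => ?_
        obtain ⟨i, hi, hle⟩ := exists_poisKer_le k t
        refine le_trans ?_ (ENNReal.le_tsum i)
        rw [indicator_of_mem hi]
        gcongr
    _ = ∑' i : ℕ, ENNReal.ofReal (8 * (1 / 2) ^ i) * ((ENNReal.ofReal (2 * (2:ℝ) ^ (k + i)))⁻¹ *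
          ∫⁻ t in Metric.closedBall x ((2:ℝ) ^ (k + i)), g t) := by
        have hm : ∀ i : ℕ, Measurable ((Metric.closedBall (0:ℝ) ((2:ℝ) ^ (k + i))).indicator
            (fun t => g (x - t))) := fun i =>
          (hg.comp (measurable_const.sub measurable_id)).indicator
            Metric.isClosed_closedBall.measurableSet
        rw [lintegral_tsum fun i => ((hm i).const_mul _).aemeasurable]
        refine tsum_congr fun i => ?_
        rw [lintegral_const_mul _ (hm i), hball, ENNReal.ofReal_mul (by positivity),
          ENNReal.ofReal_inv_of_pos (by positivity), mul_assoc]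
    _ ≤ ∑' i : ℕ, ENNReal.ofReal (8 * (1 / 2) ^ i) * avgMax g x := by
        refine ENNReal.tsum_le_tsum fun i => mul_le_mul_right ?_ _
        exact le_iSup (fun k : ℤ => (ENNReal.ofReal (2 * (2:ℝ) ^ k))⁻¹
          * ∫⁻ t in Metric.closedBall x ((2:ℝ) ^ k), g t) (k + i)
    _ = 16 * avgMax g x := by
        rw [ENNReal.tsum_mul_right, ← ENNReal.ofReal_tsum_of_nonneg (fun i => by positivity)
          (summable_geometric_two.mul_left 8), tsum_mul_left, tsum_geometric_two]
        norm_num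

lemma poisMax_le_const {g : ℝ → ℝ≥0∞} (hg : Measurable g) {c : ℝ≥0∞} (hgc : ∀ t, g t ≤ c)
    (x : ℝ) : poisMax g x ≤ 16 * c :=
  (poisMax_le g hg x).trans (mul_le_mul_right (avgMax_le_const hgc x) _)

lemma lintegral_poisMax_rpow_le {g : ℝ → ℝ≥0∞} (hg : Measurable g) {B : ℝ≥0∞} (hB : B ≠ ⊤)
    (hgB : ∀ t, g t ≤ B) {p : ℝ} (hp : 1 < p) (hp2 : p ≤ 2) :
    ∫⁻ x, poisMax g x ^ p ≤ ENNReal.ofReal (8192 / (p - 1)) * ∫⁻ x, g x ^ p := by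
  have hp0 : 0 < p - 1 := by linarith
  calc ∫⁻ x, poisMax g x ^ p ≤ ∫⁻ x, 256 * avgMax g x ^ p := by
        refine lintegral_mono fun x => ?_
        calc poisMax g x ^ p ≤ (16 * avgMax g x) ^ p := by
              have := poisMax_le g hg x
              gcongr
          _ = (16:ℝ≥0∞) ^ p * avgMax g x ^ p := ENNReal.mul_rpow_of_nonneg _ _ (by linarith)
          _ ≤ 256 * avgMax g x ^ p := by
              gcongr
              calc (16:ℝ≥0∞) ^ p ≤ 16 ^ (2:ℝ) :=
                    ENNReal.rpow_le_rpow_of_exponent_le (by norm_num) hp2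
                _ = 256 := by rw [ENNReal.rpow_ofNat]; norm_num
    _ = 256 * ∫⁻ x, avgMax g x ^ p := lintegral_const_mul _ ((measurable_avgMax hg).pow_const p)
    _ ≤ 256 * (ENNReal.ofReal (32 / (p - 1)) * ∫⁻ x, g x ^ p) := by
        gcongr
        exact lintegral_avgMax_rpow_le hg hB hgB hp hp2
    _ = ENNReal.ofReal (8192 / (p - 1)) * ∫⁻ x, g x ^ p := by
        rw [← mul_assoc, show (256:ℝ≥0∞) = ENNReal.ofReal 256 by simp,
          ← ENNReal.ofReal_mul (by norm_num)]
        congr 2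
        ring

/-- The iterated (strong) maximal function on the plane. -/
def strongMax (g : ℝ × ℝ → ℝ≥0∞) (x : ℝ × ℝ) : ℝ≥0∞ :=
  poisMax (fun y => poisMax (fun z => g (y, z)) x.2) x.1

lemma measurable_poisMax_fst {α : Type*} [MeasurableSpace α] {h : α → ℝ → ℝ≥0∞}
    (hh : Measurable (Function.uncurry h)) :
    Measurable fun q : α × ℝ => poisMax (h q.1) q.2 := by
  refine Measurable.iSup fun k => ?_
  refine Measurable.lintegral_prod_right'
    (f := fun w : (α × ℝ) × ℝ => ENNReal.ofReal (poisKer ((2:ℝ) ^ k) w.2) * h w.1.1 (w.1.2 - w.2)) ?_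
  refine ((measurable_poisKer _).comp measurable_snd).ennreal_ofReal.mul ?_
  exact hh.comp (f := fun w : (α × ℝ) × ℝ => (w.1.1, w.1.2 - w.2)) (by fun_prop)

lemma lintegral_strongMax_rpow_le {g : ℝ × ℝ → ℝ≥0∞} (hg : Measurable g) {B : ℝ≥0∞}
    (hB : B ≠ ⊤) (hgB : ∀ t, g t ≤ B) {p : ℝ} (hp : 1 < p) (hp2 : p ≤ 2) :
    ∫⁻ x, strongMax g x ^ p ≤ ENNReal.ofReal (8192 / (p - 1)) ^ 2 * ∫⁻ x, g x ^ p := by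
  set K := ENNReal.ofReal (8192 / (p - 1)) with hK
  have hm2 : Measurable fun q : ℝ × ℝ => poisMax (fun z => g (q.1, z)) q.2 :=
    measurable_poisMax_fst (h := fun y z => g (y, z)) hg
  have hm1 : Measurable (strongMax g) := by
    have h1 : Measurable (Function.uncurry fun w y : ℝ => poisMax (fun z => g (y, z)) w) :=
      hm2.comp (f := fun q : ℝ × ℝ => (q.2, q.1)) (by fun_prop)
    exact (measurable_poisMax_fst h1).comp (f := fun q : ℝ × ℝ => (q.2, q.1)) (by fun_prop)
  have hgy : ∀ y, Measurable fun z => g (y, z) := fun y => hg.comp measurable_prodMk_left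
  calc ∫⁻ x, strongMax g x ^ p
      = ∫⁻ w, ∫⁻ v, poisMax (fun y => poisMax (fun z => g (y, z)) w) v ^ p := by
        rw [Measure.volume_eq_prod, lintegral_prod_symm _ (hm1.pow_const p).aemeasurable]
        rfl
    _ ≤ ∫⁻ w, K * ∫⁻ y, poisMax (fun z => g (y, z)) w ^ p := by
        refine lintegral_mono fun w => ?_
        exact lintegral_poisMax_rpow_le (hm2.comp measurable_prodMk_right)
          (ENNReal.mul_ne_top (by norm_num) hB)
          (fun y => poisMax_le_const (hgy y) (fun z => hgB _) w) hp hp2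
    _ = K * ∫⁻ w, ∫⁻ y, poisMax (fun z => g (y, z)) w ^ p :=
        lintegral_const_mul _ ((hm2.pow_const p).lintegral_prod_left')
    _ = K * ∫⁻ y, ∫⁻ w, poisMax (fun z => g (y, z)) w ^ p := by
        rw [lintegral_lintegral_swap]
        exact ((hm2.pow_const p).comp measurable_swap).aemeasurable
    _ ≤ K * ∫⁻ y, K * ∫⁻ z, g (y, z) ^ p := by
        refine mul_le_mul_right (lintegral_mono fun y => ?_) _
        exact lintegral_poisMax_rpow_le (hgy y) hB (fun z => hgB _) hp hp2
    _ = K ^ 2 * ∫⁻ x, g x ^ p := by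
        rw [lintegral_const_mul _ ((hg.pow_const p).lintegral_prod_right'), ← mul_assoc, ← sq,
          Measure.volume_eq_prod, lintegral_prod _ (hg.pow_const p).aemeasurable]

lemma lintegral_poisKer_mul_le (g : ℝ → ℝ≥0∞) (hg : Measurable g) (x : ℝ) {r : ℝ} (hr : 0 < r) :
    ∫⁻ t, ENNReal.ofReal (poisKer r t) * g (x - t) ≤ 2 * poisMax g x := by
  obtain ⟨k, hk1, hk2⟩ := exists_mem_Ico_zpow hr one_lt_two
  have hle : ∀ t, poisKer r t ≤ 2 * poisKer ((2:ℝ) ^ k) t := by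
    intro t
    have h0 : (0:ℝ) < 2 ^ k := by positivity
    rw [zpow_add_one₀ two_ne_zero] at hk2
    unfold poisKer
    rw [← mul_div_assoc]
    gcongr
    linarith
  calc ∫⁻ t, ENNReal.ofReal (poisKer r t) * g (x - t)
      ≤ ∫⁻ t, 2 * (ENNReal.ofReal (poisKer ((2:ℝ) ^ k) t) * g (x - t)) := by
        refine lintegral_mono fun t => ?_
        rw [← mul_assoc]
        refine mul_le_mul_left ?_ _
        rw [show (2:ℝ≥0∞) = ENNReal.ofReal 2 by simp, ← ENNReal.ofReal_mul (by norm_num)]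
        exact ENNReal.ofReal_le_ofReal (hle t)
    _ = 2 * ∫⁻ t, ENNReal.ofReal (poisKer ((2:ℝ) ^ k) t) * g (x - t) :=
        lintegral_const_mul _ ((measurable_poisKer _).ennreal_ofReal.mul
          (hg.comp (measurable_const.sub measurable_id)))
    _ ≤ 2 * poisMax g x := by
        gcongr
        exact le_iSup (fun k : ℤ => ∫⁻ t, ENNReal.ofReal (poisKer ((2:ℝ) ^ k) t) * g (x - t)) k

lemma lintegral_poisKer_prod_le {g : ℝ × ℝ → ℝ≥0∞} (hg : Measurable g) (x : ℝ × ℝ) {r s : ℝ}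
    (hr : 0 < r) (hs : 0 < s) :
    ∫⁻ z : ℝ × ℝ, ENNReal.ofReal (poisKer r z.1 * poisKer s z.2) * g (x - z)
      ≤ 4 * strongMax g x := by
  have hm2 : Measurable fun q : ℝ × ℝ => poisMax (fun z => g (q.1, z)) q.2 :=
    measurable_poisMax_fst (h := fun y z => g (y, z)) hg
  have hgy : ∀ y, Measurable fun z => g (y, z) := fun y => hg.comp measurable_prodMk_left
  have hm : Measurable fun z : ℝ × ℝ =>
      ENNReal.ofReal (poisKer r z.1 * poisKer s z.2) * g (x - z) := by
    refine Measurable.mul ?_ (hg.comp (measurable_const.sub measurable_id))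
    exact (((measurable_poisKer r).comp measurable_fst).mul
      ((measurable_poisKer s).comp measurable_snd)).ennreal_ofReal
  rw [Measure.volume_eq_prod, lintegral_prod _ hm.aemeasurable]
  calc ∫⁻ v, ∫⁻ w, ENNReal.ofReal (poisKer r v * poisKer s w) * g (x - (v, w))
      = ∫⁻ v, ENNReal.ofReal (poisKer r v) *
          ∫⁻ w, ENNReal.ofReal (poisKer s w) * g (x.1 - v, x.2 - w) := by
        refine lintegral_congr fun v => ?_
        rw [← lintegral_const_mul]
        · refine lintegral_congr fun w => ?_
          rw [ENNReal.ofReal_mul (poisKer_nonneg hr.le v), mul_assoc]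
          rfl
        · exact (measurable_poisKer _).ennreal_ofReal.mul
            ((hgy _).comp (measurable_const.sub measurable_id))
    _ ≤ ∫⁻ v, ENNReal.ofReal (poisKer r v) * (2 * poisMax (fun z => g (x.1 - v, z)) x.2) := by
        refine lintegral_mono fun v => mul_le_mul_right ?_ _
        exact lintegral_poisKer_mul_le _ (hgy _) x.2 hs
    _ = 2 * ∫⁻ v, ENNReal.ofReal (poisKer r v) * poisMax (fun z => g (x.1 - v, z)) x.2 := by
        rw [← lintegral_const_mul]
        · exact lintegral_congr fun v => mul_left_comm _ _ _
        · refine (measurable_poisKer _).ennreal_ofReal.mul ?_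
          exact hm2.comp (f := fun v => (x.1 - v, x.2)) (by fun_prop)
    _ ≤ 2 * (2 * strongMax g x) := by
        refine mul_le_mul_right ?_ _
        exact lintegral_poisKer_mul_le (fun y => poisMax (fun z => g (y, z)) x.2)
          (hm2.comp measurable_prodMk_right) x.1 hr
    _ = 4 * strongMax g x := by rw [← mul_assoc]; norm_num

/-- Smooth amplitudes supported in `[1/2, 2]`. -/
def IsAmplitude (ψ : ℝ → ℂ) : Prop :=
  ContDiff ℝ (⊤ : ℕ∞) ψ ∧ ∀ t, t ∉ Icc (1 / 2 : ℝ) 2 → ψ t = 0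

lemma IsAmplitude.hasCompactSupport {ψ : ℝ → ℂ} (h : IsAmplitude ψ) : HasCompactSupport ψ :=
  HasCompactSupport.intro isCompact_Icc h.2

lemma IsAmplitude.integrable {ψ : ℝ → ℂ} (h : IsAmplitude ψ) : Integrable ψ :=
  h.1.continuous.integrable_of_hasCompactSupport h.hasCompactSupport

lemma IsAmplitude.deriv {ψ : ℝ → ℂ} (h : IsAmplitude ψ) : IsAmplitude (deriv ψ) := by
  refine ⟨h.1.deriv' , fun t ht => ?_⟩
  have : ψ =ᶠ[𝓝 t] fun _ => 0 := by
    filter_upwards [isClosed_Icc.isOpen_compl.mem_nhds ht] with s hs using h.2 s hs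
  rw [this.deriv_eq, deriv_const]

lemma IsAmplitude.mul {ψ : ℝ → ℂ} (h : IsAmplitude ψ) {g : ℝ → ℂ}
    (hg : ContDiffOn ℝ (⊤ : ℕ∞) g (Ioi 0)) : IsAmplitude fun t => ψ t * g t := by
  refine ⟨contDiff_iff_contDiffAt.2 fun t => ?_, fun t ht => by simp [h.2 t ht]⟩
  rcases lt_or_ge 0 t with ht | ht
  · exact h.1.contDiffAt.mul (hg.contDiffAt (Ioi_mem_nhds ht))
  · have : (fun t => ψ t * g t) =ᶠ[𝓝 t] fun _ => 0 := by
      filter_upwards [Iio_mem_nhds (show t < 1 / 2 by linarith)] with s hs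
      rw [h.2 s (fun hs' => absurd hs (not_lt.2 hs'.1)), zero_mul]
    exact contDiffAt_const.congr_of_eventuallyEq this

lemma IsAmplitude.left_eq_zero {ψ : ℝ → ℂ} (h : IsAmplitude ψ) : ψ (1 / 2) = 0 := by
  have hc : IsClosed {t | ψ t = 0} := isClosed_eq h.1.continuous continuous_const
  have : Iio (1 / 2 : ℝ) ⊆ {t | ψ t = 0} := fun t ht => h.2 t fun h' => absurd ht (not_lt.2 h'.1)
  have h2 := closure_minimal this hc
  rw [closure_Iio] at h2
  exact h2 (mem_Iic.2 le_rfl)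

lemma IsAmplitude.right_eq_zero {ψ : ℝ → ℂ} (h : IsAmplitude ψ) : ψ 2 = 0 := by
  have hc : IsClosed {t | ψ t = 0} := isClosed_eq h.1.continuous continuous_const
  have : Ioi (2 : ℝ) ⊆ {t | ψ t = 0} := fun t ht => h.2 t fun h' => absurd ht (not_lt.2 h'.2)
  have h2 := closure_minimal this hc
  rw [closure_Ioi] at h2
  exact h2 (mem_Ici.2 le_rfl)

lemma contDiffOn_ofReal_rpow (s : ℝ) :
    ContDiffOn ℝ (⊤ : ℕ∞) (fun t : ℝ => ((t ^ s : ℝ) : ℂ)) (Ioi 0) := by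
  refine Complex.ofRealCLM.contDiff.comp_contDiffOn ?_
  exact fun t ht => (Real.contDiffAt_rpow_const_of_ne (ne_of_gt ht)).contDiffWithinAt

/-- The unimodular factor `e^{-2πi(ξ₁ t + ξ₂ c t^b)}`. -/
def oscFactor (b c : ℝ) (ξ : ℝ × ℝ) (t : ℝ) : ℂ :=
  Complex.exp (((-(2 * Real.pi * (ξ.1 * t + ξ.2 * (c * t ^ b))) : ℝ) : ℂ) * Complex.I)

lemma norm_oscFactor (b c : ℝ) (ξ : ℝ × ℝ) (t : ℝ) : ‖oscFactor b c ξ t‖ = 1 :=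
  Complex.norm_exp_ofReal_mul_I _

/-- The oscillatory integral with amplitude `ψ`. -/
def oscInt (b c : ℝ) (ψ : ℝ → ℂ) (ξ : ℝ × ℝ) : ℂ :=
  ∫ t : ℝ, oscFactor b c ξ t * ψ t

/-- The derivative of the phase. -/
def phaseDeriv (b c : ℝ) (ξ : ℝ × ℝ) (t : ℝ) : ℝ := ξ.1 + ξ.2 * (c * (b * t ^ (b - 1)))

/-- Oscillatory integrals with negative powers of the phase derivative. -/
def oscIntDiv (b c : ℝ) (ψ : ℝ → ℂ) (n : ℕ) (ξ : ℝ × ℝ) : ℂ :=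
  ∫ t in (1 / 2 : ℝ)..2, oscFactor b c ξ t * (ψ t * ((phaseDeriv b c ξ t : ℂ)⁻¹) ^ n)

lemma oscInt_eq_oscIntDiv {b c : ℝ} {ψ : ℝ → ℂ} (h : IsAmplitude ψ) (ξ : ℝ × ℝ) :
    oscInt b c ψ ξ = oscIntDiv b c ψ 0 ξ := by
  unfold oscInt oscIntDiv
  rw [intervalIntegral.integral_of_le (by norm_num), ← integral_Icc_eq_integral_Ioc,
    setIntegral_eq_integral_of_forall_compl_eq_zero]
  · simp
  · intro t ht
    simp [h.2 t ht]

lemma hasDerivAt_oscFactor (b c : ℝ) (ξ : ℝ × ℝ) {t : ℝ} (ht : 0 < t) :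
    HasDerivAt (oscFactor b c ξ)
      (oscFactor b c ξ t * (-(2 * Real.pi * Complex.I) * phaseDeriv b c ξ t)) t := by
  have h1 : HasDerivAt (fun t : ℝ => -(2 * Real.pi * (ξ.1 * t + ξ.2 * (c * t ^ b))))
      (-(2 * Real.pi * phaseDeriv b c ξ t)) t := by
    unfold phaseDeriv
    have hr := Real.hasDerivAt_rpow_const (x := t) (p := b) (Or.inl ht.ne')
    refine (((((hasDerivAt_id' t).const_mul ξ.1).fun_add ((hr.const_mul c).const_mul ξ.2)).const_mul
      (2 * Real.pi)).fun_neg).congr_deriv ?_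
    ring
  have h2 := ((h1.ofReal_comp).mul_const Complex.I).cexp
  refine h2.congr_deriv ?_
  unfold oscFactor
  push_cast
  ring

lemma hasDerivAt_phaseDeriv (b c : ℝ) (ξ : ℝ × ℝ) {t : ℝ} (ht : 0 < t) :
    HasDerivAt (fun t => (phaseDeriv b c ξ t : ℂ))
      ((ξ.2 * ((c * (b * (b - 1))) * t ^ (b - 1 - 1)) : ℝ) : ℂ) t := by
  refine HasDerivAt.ofReal_comp ?_
  unfold phaseDeriv
  have hr := Real.hasDerivAt_rpow_const (x := t) (p := b - 1) (Or.inl ht.ne')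
  refine ((((hr.const_mul b).const_mul c).const_mul ξ.2).const_add ξ.1).congr_deriv ?_
  ring

lemma continuousOn_oscFactor (b c : ℝ) (ξ : ℝ × ℝ) :
    ContinuousOn (oscFactor b c ξ) (Icc (1 / 2) 2) := fun t ht =>
  (hasDerivAt_oscFactor b c ξ (lt_of_lt_of_le (by norm_num) ht.1)).continuousAt.continuousWithinAt

lemma continuousOn_phaseDeriv (b c : ℝ) (ξ : ℝ × ℝ) :
    ContinuousOn (fun t => (phaseDeriv b c ξ t : ℂ)) (Icc (1 / 2) 2) := fun t ht =>
  (hasDerivAt_phaseDeriv b c ξ (lt_of_lt_of_le (by norm_num) ht.1)).continuousAt.continuousWithinAt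

lemma oscIntDiv_integrationByParts {b c : ℝ} {ψ : ℝ → ℂ} (h : IsAmplitude ψ) (n : ℕ) {ξ : ℝ × ℝ}
    (hξ : ∀ t ∈ Icc (1 / 2 : ℝ) 2, phaseDeriv b c ξ t ≠ 0) :
    (2 * Real.pi * Complex.I) * oscIntDiv b c ψ n ξ =
      oscIntDiv b c (deriv ψ) (n + 1) ξ
      - (n + 1) * ξ.2 * oscIntDiv b c
          (fun t => ψ t * (((c * (b * (b - 1)) : ℝ) : ℂ) * ((t ^ (b - 1 - 1) : ℝ) : ℂ))) (n + 2) ξ := by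
  set D : ℝ → ℂ := fun t => (phaseDeriv b c ξ t : ℂ) with hD
  set q : ℝ → ℂ := fun t => ((c * (b * (b - 1)) : ℝ) : ℂ) * ((t ^ (b - 1 - 1) : ℝ) : ℂ) with hq
  have hu : uIcc (1 / 2 : ℝ) 2 = Icc (1 / 2) 2 := uIcc_of_le (by norm_num)
  have hpos : ∀ t ∈ Icc (1 / 2 : ℝ) 2, 0 < t := fun t ht => lt_of_lt_of_le (by norm_num) ht.1
  have hD0 : ∀ t ∈ Icc (1 / 2 : ℝ) 2, D t ≠ 0 := fun t ht => Complex.ofReal_ne_zero.2 (hξ t ht)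
  have hDc : ContinuousOn D (Icc (1 / 2) 2) := continuousOn_phaseDeriv b c ξ
  have hDi : ContinuousOn (fun t => (D t)⁻¹) (Icc (1 / 2) 2) := hDc.inv₀ hD0
  have hEc := continuousOn_oscFactor b c ξ
  have hψc : ContinuousOn ψ (Icc (1 / 2) 2) := h.1.continuous.continuousOn
  have hψ'c : ContinuousOn (deriv ψ) (Icc (1 / 2) 2) := h.deriv.1.continuous.continuousOn
  have hqc : ContinuousOn q (Icc (1 / 2) 2) :=
    continuousOn_const.mul ((contDiffOn_ofReal_rpow _).continuousOn.mono hpos)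
  have hv : ∀ t ∈ uIcc (1 / 2 : ℝ) 2, HasDerivAt (fun t => ψ t * ((D t)⁻¹) ^ (n + 1))
      (deriv ψ t * ((D t)⁻¹) ^ (n + 1) - (n + 1) * ξ.2 * ((ψ t * q t) * ((D t)⁻¹) ^ (n + 2))) t := by
    intro t ht
    rw [hu] at ht
    have h1 := (h.1.differentiable (by simp) t).hasDerivAt
    have h2 := ((hasDerivAt_phaseDeriv b c ξ (hpos t ht)).inv (hD0 t ht)).pow (n + 1)
    refine (h1.mul h2).congr_deriv ?_
    have := hD0 t ht
    simp only [hq, Pi.inv_apply, Pi.pow_apply, Nat.add_sub_cancel]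
    push_cast
    simp only [hD]
    ring
  have hparts := intervalIntegral.integral_mul_deriv_eq_deriv_mul
    (u := fun t => ψ t * ((D t)⁻¹) ^ (n + 1)) (v := oscFactor b c ξ)
    hv (fun t ht => hasDerivAt_oscFactor b c ξ (hpos t (hu ▸ ht)))
    (ContinuousOn.intervalIntegrable (by
      rw [hu]
      exact (hψ'c.mul (hDi.pow _)).sub (continuousOn_const.mul ((hψc.mul hqc).mul (hDi.pow _)))))
    (ContinuousOn.intervalIntegrable (by
      rw [hu]; exact hEc.mul (continuousOn_const.mul hDc)))
  simp only [h.left_eq_zero, h.right_eq_zero, zero_mul, sub_zero, zero_sub] at hparts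
  have hL : ∫ t in (1 / 2 : ℝ)..2, (ψ t * ((D t)⁻¹) ^ (n + 1)) *
      (oscFactor b c ξ t * (-(2 * Real.pi * Complex.I) * phaseDeriv b c ξ t))
      = -(2 * Real.pi * Complex.I) * oscIntDiv b c ψ n ξ := by
    unfold oscIntDiv
    rw [← intervalIntegral.integral_const_mul]
    refine intervalIntegral.integral_congr fun t ht => ?_
    rw [hu] at ht
    have := hD0 t ht
    have h1 : D t * (D t)⁻¹ = 1 := mul_inv_cancel₀ this
    change (ψ t * ((D t)⁻¹) ^ (n + 1)) * (oscFactor b c ξ t * (-(2 * Real.pi * Complex.I) * D t))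
      = -(2 * Real.pi * Complex.I) * (oscFactor b c ξ t * (ψ t * ((D t)⁻¹) ^ n))
    linear_combination (-(2 * Real.pi * Complex.I) * (oscFactor b c ξ t * (ψ t * ((D t)⁻¹) ^ n))) * h1
  have hi1 : IntervalIntegrable (fun t => oscFactor b c ξ t * (deriv ψ t * ((D t)⁻¹) ^ (n + 1)))
      volume (1 / 2) 2 := ContinuousOn.intervalIntegrable (by
    rw [hu]; exact hEc.mul (hψ'c.mul (hDi.pow _)))
  have hi2 : IntervalIntegrable (fun t => ((n:ℂ) + 1) * ξ.2 *
      (oscFactor b c ξ t * ((ψ t * q t) * ((D t)⁻¹) ^ (n + 2))))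
      volume (1 / 2) 2 := ContinuousOn.intervalIntegrable (by
    rw [hu]; exact continuousOn_const.mul (hEc.mul ((hψc.mul hqc).mul (hDi.pow _))))
  have hR : ∫ t in (1 / 2 : ℝ)..2, (deriv ψ t * ((D t)⁻¹) ^ (n + 1)
        - (n + 1) * ξ.2 * ((ψ t * q t) * ((D t)⁻¹) ^ (n + 2))) * oscFactor b c ξ t
      = oscIntDiv b c (deriv ψ) (n + 1) ξ
        - (n + 1) * ξ.2 * oscIntDiv b c (fun t => ψ t * q t) (n + 2) ξ := by
    unfold oscIntDiv
    rw [← intervalIntegral.integral_const_mul, ← intervalIntegral.integral_sub hi1 hi2]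
    refine intervalIntegral.integral_congr fun t _ => ?_
    ring
  rw [hL, hR] at hparts
  linear_combination -hparts

lemma exists_oscIntDiv_mul_pow_le {b c κ : ℝ} (hκ : 0 < κ) (N : ℕ) :
    ∀ (ψ : ℝ → ℂ), IsAmplitude ψ → ∀ n : ℕ, ∃ C : ℝ, ∀ ξ : ℝ × ℝ, 0 < ‖ξ‖ →
      (∀ t ∈ Icc (1 / 2 : ℝ) 2, κ * ‖ξ‖ ≤ |phaseDeriv b c ξ t|) →
      ‖oscIntDiv b c ψ n ξ‖ * ‖ξ‖ ^ (n + N) ≤ C := by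
  induction N with
  | zero =>
    intro ψ h n
    obtain ⟨A, hA⟩ := h.hasCompactSupport.exists_bound_of_continuous h.1.continuous
    refine ⟨A * (κ⁻¹) ^ n * (2 - 1 / 2), fun ξ hξ hcone => ?_⟩
    have hb : ‖oscIntDiv b c ψ n ξ‖ ≤ A * ((κ * ‖ξ‖)⁻¹) ^ n * |(2:ℝ) - 1 / 2| := by
      refine intervalIntegral.norm_integral_le_of_norm_le_const fun t ht => ?_
      rw [uIoc_of_le (by norm_num)] at ht
      rw [norm_mul, norm_oscFactor, one_mul, norm_mul, norm_pow, norm_inv, Complex.norm_real,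
        Real.norm_eq_abs]
      have := hcone t ⟨ht.1.le, ht.2⟩
      have hA0 : 0 ≤ A := (norm_nonneg _).trans (hA t)
      have hAt := hA t
      gcongr
    calc ‖oscIntDiv b c ψ n ξ‖ * ‖ξ‖ ^ (n + 0)
        ≤ (A * ((κ * ‖ξ‖)⁻¹) ^ n * |(2:ℝ) - 1 / 2|) * ‖ξ‖ ^ (n + 0) := by gcongr
      _ = A * (κ⁻¹) ^ n * (2 - 1 / 2) := by
        rw [abs_of_nonneg (by norm_num), add_zero, mul_inv, mul_pow, inv_pow ‖ξ‖]
        field_simp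
  | succ N ih =>
    intro ψ h n
    have h2 : IsAmplitude
        (fun t => ψ t * (((c * (b * (b - 1)) : ℝ) : ℂ) * ((t ^ (b - 1 - 1) : ℝ) : ℂ))) :=
      h.mul (contDiffOn_const.mul (contDiffOn_ofReal_rpow _))
    obtain ⟨C1, hC1⟩ := ih _ h.deriv (n + 1)
    obtain ⟨C2, hC2⟩ := ih _ h2 (n + 2)
    refine ⟨C1 + (n + 1) * C2, fun ξ hξ hcone => ?_⟩
    have hne : ∀ t ∈ Icc (1 / 2 : ℝ) 2, phaseDeriv b c ξ t ≠ 0 := fun t ht =>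
      abs_pos.1 (lt_of_lt_of_le (by positivity) (hcone t ht))
    have heq := oscIntDiv_integrationByParts h n hne
    have h1' := hC1 ξ hξ hcone
    have h2' := hC2 ξ hξ hcone
    set J0 := oscIntDiv b c ψ n ξ
    set J1 := oscIntDiv b c (deriv ψ) (n + 1) ξ
    set J2 := oscIntDiv b c
      (fun t => ψ t * (((c * (b * (b - 1)) : ℝ) : ℂ) * ((t ^ (b - 1 - 1) : ℝ) : ℂ))) (n + 2) ξ
    have hnorm : ‖J0‖ ≤ ‖J1‖ + (n + 1) * ‖ξ‖ * ‖J2‖ := by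
      have e1 : ‖(2 * Real.pi * Complex.I) * J0‖ = 2 * Real.pi * ‖J0‖ := by
        rw [norm_mul, norm_mul, norm_mul, Complex.norm_I, Complex.norm_real, Real.norm_eq_abs,
          abs_of_pos Real.pi_pos, mul_one]
        simp
      have e2 : ‖J1 - (n + 1) * ξ.2 * J2‖ ≤ ‖J1‖ + (n + 1) * ‖ξ‖ * ‖J2‖ := by
        refine (norm_sub_le _ _).trans ?_
        rw [norm_mul, norm_mul, Complex.norm_real]
        have : ‖(n:ℂ) + 1‖ = n + 1 := by
          rw [show (n:ℂ) + 1 = ((n + 1 : ℕ) : ℂ) by push_cast; rfl, Complex.norm_natCast]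
          push_cast; rfl
        rw [this]
        have := norm_snd_le ξ
        gcongr
      rw [heq] at e1
      have hpi : 1 ≤ 2 * Real.pi := by linarith [Real.pi_gt_three]
      nlinarith [norm_nonneg J0]
    calc ‖J0‖ * ‖ξ‖ ^ (n + (N + 1))
        ≤ (‖J1‖ + (n + 1) * ‖ξ‖ * ‖J2‖) * ‖ξ‖ ^ (n + (N + 1)) := by gcongr
      _ = ‖J1‖ * ‖ξ‖ ^ (n + 1 + N) + (n + 1) * (‖J2‖ * ‖ξ‖ ^ (n + 2 + N)) := by ring
      _ ≤ C1 + (n + 1) * C2 := by gcongr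

lemma exists_oscInt_mul_pow_le {b c κ : ℝ} (hκ : 0 < κ) {ψ : ℝ → ℂ} (h : IsAmplitude ψ) (N : ℕ) :
    ∃ C : ℝ, ∀ ξ : ℝ × ℝ, 0 < ‖ξ‖ →
      (∀ t ∈ Icc (1 / 2 : ℝ) 2, κ * ‖ξ‖ ≤ |phaseDeriv b c ξ t|) →
      ‖oscInt b c ψ ξ‖ * ‖ξ‖ ^ N ≤ C := by
  obtain ⟨C, hC⟩ := exists_oscIntDiv_mul_pow_le (b := b) (c := c) hκ N ψ h 0
  refine ⟨C, fun ξ hξ hcone => ?_⟩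
  rw [oscInt_eq_oscIntDiv h]
  simpa using hC ξ hξ hcone

lemma measurable_oscFactor (b c : ℝ) (ξ : ℝ × ℝ) : Measurable (oscFactor b c ξ) := by
  unfold oscFactor
  fun_prop

lemma norm_oscInt_le (b c : ℝ) (ψ : ℝ → ℂ) (ξ : ℝ × ℝ) : ‖oscInt b c ψ ξ‖ ≤ ∫ t, ‖ψ t‖ := by
  refine (norm_integral_le_integral_norm _).trans (le_of_eq ?_)
  simp [norm_oscFactor]

lemma continuous_oscInt {b c : ℝ} {ψ : ℝ → ℂ} (h : IsAmplitude ψ) : Continuous (oscInt b c ψ) := by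
  unfold oscInt
  refine continuous_of_dominated (bound := fun t => ‖ψ t‖) (fun ξ => ?_) (fun ξ => ?_)
    h.integrable.norm ?_
  · exact ((measurable_oscFactor b c ξ).mul h.1.continuous.measurable).aestronglyMeasurable
  · exact Eventually.of_forall fun t => by simp [norm_oscFactor]
  · refine Eventually.of_forall fun t => ?_
    unfold oscFactor
    fun_prop

/-- Differentiating `oscInt` in the direction `e` multiplies the amplitude by this factor. -/
def dirFactor (b c : ℝ) (e : ℝ × ℝ) (t : ℝ) : ℂ :=
  -(2 * Real.pi * Complex.I) * (e.1 * t + e.2 * (c * ((t ^ b : ℝ) : ℂ)))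

lemma contDiffOn_dirFactor (b c : ℝ) (e : ℝ × ℝ) :
    ContDiffOn ℝ (⊤ : ℕ∞) (dirFactor b c e) (Ioi 0) := by
  unfold dirFactor
  exact contDiffOn_const.mul ((contDiffOn_const.mul Complex.ofRealCLM.contDiff.contDiffOn).add
    (contDiffOn_const.mul (contDiffOn_const.mul (contDiffOn_ofReal_rpow b))))

lemma hasLineDerivAt_oscInt {b c : ℝ} {ψ : ℝ → ℂ} (h : IsAmplitude ψ) (ξ e : ℝ × ℝ) :
    HasLineDerivAt ℝ (oscInt b c ψ) (oscInt b c (fun t => ψ t * dirFactor b c e t) ξ) ξ e := by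
  have h' := h.mul (contDiffOn_dirFactor b c e)
  have key := hasDerivAt_integral_of_dominated_loc_of_deriv_le (μ := (volume : Measure ℝ))
    (F := fun (s : ℝ) t => oscFactor b c (ξ + s • e) t * ψ t)
    (F' := fun (s : ℝ) t => oscFactor b c (ξ + s • e) t * (ψ t * dirFactor b c e t))
    (x₀ := 0) (s := univ) (bound := fun t => ‖ψ t * dirFactor b c e t‖) univ_mem
    (Eventually.of_forall fun s =>
      ((measurable_oscFactor b c _).mul h.1.continuous.measurable).aestronglyMeasurable)
    (by
      refine h.integrable.mono
        ((measurable_oscFactor b c _).mul h.1.continuous.measurable).aestronglyMeasurable ?_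
      exact Eventually.of_forall fun t => by simp [norm_oscFactor])
    ((measurable_oscFactor b c _).mul h'.1.continuous.measurable).aestronglyMeasurable
    (Eventually.of_forall fun t s _ => by simp [norm_oscFactor])
    h'.integrable.norm
    (Eventually.of_forall fun t s _ => by
      have h1 : HasDerivAt (fun s : ℝ =>
          -(2 * Real.pi * ((ξ.1 + s * e.1) * t + (ξ.2 + s * e.2) * (c * t ^ b))))
          (-(2 * Real.pi * (e.1 * t + e.2 * (c * t ^ b)))) s := by
        refine (((((((hasDerivAt_id' s).mul_const e.1).const_add ξ.1).mul_const t).fun_add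
          ((((hasDerivAt_id' s).mul_const e.2).const_add ξ.2).mul_const (c * t ^ b))).const_mul
          (2 * Real.pi)).fun_neg).congr_deriv ?_
        ring
      have h2 := (((h1.ofReal_comp).mul_const Complex.I).cexp).mul_const (ψ t)
      refine h2.congr_deriv ?_
      simp only [oscFactor, dirFactor, Prod.fst_add, Prod.snd_add, Prod.smul_fst, Prod.smul_snd,
        smul_eq_mul]
      push_cast
      ring)
  have := key.2
  simp only [zero_smul, add_zero] at this
  exact this

/-- Finite sums of products of symbols vanishing on `O` with oscillatory integrals. -/
inductive OscSymbol (b c : ℝ) (O : Set (ℝ × ℝ)) : (ℝ × ℝ → ℂ) → Prop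
  | mul (m : ℝ × ℝ → ℂ) (ψ : ℝ → ℂ) (hm : Function.HasTemperateGrowth m) (hO : ∀ ξ ∈ O, m ξ = 0)
      (hψ : IsAmplitude ψ) : OscSymbol b c O (fun ξ => m ξ * oscInt b c ψ ξ)
  | add (F G : ℝ × ℝ → ℂ) (hF : OscSymbol b c O F) (hG : OscSymbol b c O G) :
      OscSymbol b c O (fun ξ => F ξ + G ξ)

lemma OscSymbol.continuous {b c : ℝ} {O : Set (ℝ × ℝ)} {F : ℝ × ℝ → ℂ} (h : OscSymbol b c O F) :
    Continuous F := by
  induction h with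
  | mul m ψ hm hO hψ => exact hm.1.continuous.mul (continuous_oscInt hψ)
  | add F G _ _ hF hG => exact hF.add hG

lemma hasTemperateGrowth_fderiv_apply {m : ℝ × ℝ → ℂ} (hm : Function.HasTemperateGrowth m)
    (e : ℝ × ℝ) : Function.HasTemperateGrowth fun ξ => fderiv ℝ m ξ e := by
  have h1 : Function.HasTemperateGrowth (fderiv ℝ m) := by
    refine ⟨hm.1.fderiv_right (by simp), fun n => ?_⟩
    obtain ⟨k, C, hC⟩ := hm.2 (n + 1)
    refine ⟨k, C, fun x => ?_⟩
    rw [norm_iteratedFDeriv_fderiv]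
    exact hC x
  exact ((ContinuousLinearMap.apply ℝ ℂ e).hasTemperateGrowth).comp h1

lemma OscSymbol.exists_hasLineDerivAt {b c : ℝ} {O : Set (ℝ × ℝ)} (hO : IsOpen O)
    {F : ℝ × ℝ → ℂ} (h : OscSymbol b c O F) (e : ℝ × ℝ) :
    ∃ F', OscSymbol b c O F' ∧ ∀ ξ, HasLineDerivAt ℝ F (F' ξ) ξ e := by
  induction h with
  | mul m ψ hm hmO hψ =>
    refine ⟨_, OscSymbol.add _ _
      (OscSymbol.mul (fun ξ => fderiv ℝ m ξ e) ψ (hasTemperateGrowth_fderiv_apply hm e) ?_ hψ)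
      (OscSymbol.mul m _ hm hmO (hψ.mul (contDiffOn_dirFactor b c e))), fun ξ => ?_⟩
    · intro ξ hξ
      have : m =ᶠ[𝓝 ξ] fun _ => 0 := by
        filter_upwards [hO.mem_nhds hξ] with z hz using hmO z hz
      rw [this.fderiv_eq]
      simp
    · have h1 := ((hm.1.differentiable (by simp)) ξ).hasFDerivAt.hasLineDerivAt e
      have h2 := hasLineDerivAt_oscInt (b := b) (c := c) hψ ξ e
      unfold HasLineDerivAt at h1 h2 ⊢
      refine (h1.fun_mul h2).congr_deriv ?_
      simp
  | add F G _ _ hF hG =>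
    obtain ⟨F', hF', h1⟩ := hF
    obtain ⟨G', hG', h2⟩ := hG
    exact ⟨_, OscSymbol.add _ _ hF' hG', fun ξ => HasDerivAt.fun_add (h1 ξ) (h2 ξ)⟩

/-- Outside `O`, the phase derivative is elliptic at high frequencies. -/
def PhaseElliptic (b c : ℝ) (O : Set (ℝ × ℝ)) : Prop :=
  ∃ κ : ℝ, 0 < κ ∧ ∀ ξ ∉ O, 100 < ‖ξ‖ →
    ∀ t ∈ Icc (1 / 2 : ℝ) 2, κ * ‖ξ‖ ≤ |phaseDeriv b c ξ t|

lemma OscSymbol.exists_pow_mul_le {b c : ℝ} {O : Set (ℝ × ℝ)} (hE : PhaseElliptic b c O)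
    {F : ℝ × ℝ → ℂ} (h : OscSymbol b c O F) (N : ℕ) :
    ∃ C : ℝ, ∀ ξ, ‖ξ‖ ^ N * ‖F ξ‖ ≤ C := by
  induction h with
  | mul m ψ hm hmO hψ =>
    obtain ⟨κ, hκ, hcone⟩ := hE
    obtain ⟨k, A, hA0, hA⟩ := hm.norm_iteratedFDeriv_le_uniform 0
    have hA' : ∀ ξ, ‖m ξ‖ ≤ A * (1 + ‖ξ‖) ^ k := fun ξ => by simpa using hA 0 le_rfl ξ
    obtain ⟨C, hC⟩ := exists_oscInt_mul_pow_le (b := b) (c := c) hκ hψ (N + k)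
    have hM : 0 ≤ ∫ t, ‖ψ t‖ := integral_nonneg fun t => norm_nonneg _
    refine ⟨100 ^ N * (A * 101 ^ k * ∫ t, ‖ψ t‖) + A * 2 ^ k * max C 0, fun ξ => ?_⟩
    rcases le_or_gt ‖ξ‖ 100 with hξ | hξ
    · have : ‖ξ‖ ^ N * ‖m ξ * oscInt b c ψ ξ‖ ≤ 100 ^ N * (A * 101 ^ k * ∫ t, ‖ψ t‖) := by
        rw [norm_mul]
        have h1 := norm_oscInt_le b c ψ ξ
        have h2 : ‖m ξ‖ ≤ A * 101 ^ k := (hA' ξ).trans (by gcongr; linarith)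
        gcongr
      have : 0 ≤ A * 2 ^ k * max C 0 := by positivity
      linarith
    · have h0 : 0 ≤ 100 ^ N * (A * 101 ^ k * ∫ t, ‖ψ t‖) := by positivity
      by_cases hO : ξ ∈ O
      · simp only [hmO ξ hO, zero_mul, norm_zero, mul_zero]
        positivity
      · have h1 := hC ξ (by linarith) (hcone ξ hO hξ)
        have h2 : ‖m ξ‖ ≤ A * (2 * ‖ξ‖) ^ k := (hA' ξ).trans (by gcongr; linarith)
        calc ‖ξ‖ ^ N * ‖m ξ * oscInt b c ψ ξ‖ = ‖ξ‖ ^ N * (‖m ξ‖ * ‖oscInt b c ψ ξ‖) := by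
              rw [norm_mul]
          _ ≤ ‖ξ‖ ^ N * (A * (2 * ‖ξ‖) ^ k * ‖oscInt b c ψ ξ‖) := by gcongr
          _ = A * 2 ^ k * (‖oscInt b c ψ ξ‖ * ‖ξ‖ ^ (N + k)) := by ring
          _ ≤ A * 2 ^ k * max C 0 := by
              gcongr
              exact h1.trans (le_max_left _ _)
          _ ≤ _ := by linarith
  | add F G _ _ hF hG =>
    obtain ⟨C1, h1⟩ := hF
    obtain ⟨C2, h2⟩ := hG
    refine ⟨C1 + C2, fun ξ => ?_⟩
    have := norm_add_le (F ξ) (G ξ)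
    calc ‖ξ‖ ^ N * ‖F ξ + G ξ‖ ≤ ‖ξ‖ ^ N * (‖F ξ‖ + ‖G ξ‖) := by gcongr
      _ ≤ C1 + C2 := by rw [mul_add]; exact add_le_add (h1 ξ) (h2 ξ)

lemma OscSymbol.integrable {b c : ℝ} {O : Set (ℝ × ℝ)} (hE : PhaseElliptic b c O)
    {F : ℝ × ℝ → ℂ} (h : OscSymbol b c O F) : Integrable F := by
  obtain ⟨C1, h1⟩ := h.exists_pow_mul_le hE 0
  obtain ⟨C2, h2⟩ := h.exists_pow_mul_le hE (0 + (volume : Measure (ℝ × ℝ)).integrablePower)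
  have := integrable_of_le_of_pow_mul_le (μ := (volume : Measure (ℝ × ℝ))) (k := 0)
    (fun x => by simpa using h1 x) h2 h.continuous.aestronglyMeasurable
  exact (integrable_norm_iff h.continuous.aestronglyMeasurable).1 (by simpa using this)

lemma norm_FTinv_le (F : ℝ × ℝ → ℂ) (y : ℝ × ℝ) : ‖FTinv F y‖ ≤ ∫ ξ, ‖F ξ‖ := by
  refine (norm_integral_le_integral_norm _).trans (le_of_eq ?_)
  simp only [norm_mul, Complex.norm_exp_ofReal_mul_I, one_mul]

lemma norm_mul_FTinv_eq {F F' : ℝ × ℝ → ℂ} {e : ℝ × ℝ} (hF : Integrable F) (hF' : Integrable F')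
    (h : ∀ ξ, HasLineDerivAt ℝ F (F' ξ) ξ e) (y : ℝ × ℝ) :
    2 * Real.pi * |y.1 * e.1 + y.2 * e.2| * ‖FTinv F y‖ = ‖FTinv F' y‖ := by
  set E : ℝ × ℝ → ℂ := fun ξ =>
    Complex.exp (((2 * Real.pi * (y.1 * ξ.1 + y.2 * ξ.2) : ℝ) : ℂ) * Complex.I) with hE
  set w : ℂ := ((2 * Real.pi * (y.1 * e.1 + y.2 * e.2) : ℝ) : ℂ) * Complex.I with hw
  have hEc : Continuous E := by rw [hE]; fun_prop
  have hE1 : ∀ ξ, ‖E ξ‖ = 1 := fun ξ => Complex.norm_exp_ofReal_mul_I _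
  have hEd : ∀ ξ, HasLineDerivAt ℝ E (w * E ξ) ξ e := by
    intro ξ
    have h1 : HasDerivAt (fun s : ℝ =>
        2 * Real.pi * (y.1 * (ξ.1 + s * e.1) + y.2 * (ξ.2 + s * e.2)))
        (2 * Real.pi * (y.1 * e.1 + y.2 * e.2)) 0 := by
      refine (((((hasDerivAt_id' (0:ℝ)).mul_const e.1).const_add ξ.1).const_mul y.1).fun_add
        ((((hasDerivAt_id' (0:ℝ)).mul_const e.2).const_add ξ.2).const_mul y.2)).const_mul
        (2 * Real.pi) |>.congr_deriv ?_
      ring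
    have h2 := ((h1.ofReal_comp).mul_const Complex.I).cexp
    refine h2.congr_deriv ?_
    simp only [hE, hw, zero_mul, add_zero]
    ring
  have hEi : ∀ {G : ℝ × ℝ → ℂ}, Integrable G → Integrable fun ξ => E ξ * G ξ := by
    intro G hG
    refine hG.mono (hEc.aestronglyMeasurable.mul hG.1) (Eventually.of_forall fun ξ => ?_)
    rw [norm_mul, hE1, one_mul]
  have key := integral_bilinear_hasLineDerivAt_right_eq_neg_left_of_integrable
    (μ := (volume : Measure (ℝ × ℝ))) (f := E) (f' := fun ξ => w * E ξ) (g := F) (g' := F') (v := e)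
    (B := ContinuousLinearMap.mul ℝ ℂ)
    (by simpa [mul_assoc] using (hEi hF).const_mul w) (by simpa using hEi hF')
    (by simpa using hEi hF) (fun x _ => hEd x) (fun x _ => h x)
  simp only [ContinuousLinearMap.mul_apply', mul_assoc] at key
  rw [integral_const_mul] at key
  have hL : FTinv F' y = -(w * FTinv F y) := key
  rw [hL, norm_neg, norm_mul, hw, norm_mul, Complex.norm_I, Complex.norm_real, mul_one,
    Real.norm_eq_abs, abs_mul, abs_of_pos (by positivity : 0 < 2 * Real.pi)]

/-- Two derivatives in each variable, all integrable, give quadratic decay of the inverse Fourier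
transform in each variable. -/
lemma exists_FTinv_decay {P : (ℝ × ℝ → ℂ) → Prop} (hInt : ∀ F, P F → Integrable F)
    (hder : ∀ F, P F → ∀ e : ℝ × ℝ, ∃ F' : ℝ × ℝ → ℂ, P F' ∧
      ∀ ξ, HasLineDerivAt ℝ F (F' ξ) ξ e) {F : ℝ × ℝ → ℂ} (h : P F) :
    ∃ C : ℝ, 0 ≤ C ∧ ∀ y : ℝ × ℝ, (1 + y.1 ^ 2) * (1 + y.2 ^ 2) * ‖FTinv F y‖ ≤ C := by
  have step : ∀ e : ℝ × ℝ, ∀ {F : ℝ × ℝ → ℂ}, P F → ∃ G, P G ∧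
      ∀ y : ℝ × ℝ, (y.1 * e.1 + y.2 * e.2) ^ 2 * ‖FTinv F y‖ ≤ ‖FTinv G y‖ := by
    intro e F h
    obtain ⟨F1, h1, hd1⟩ := hder _ h e
    obtain ⟨F2, h2, hd2⟩ := hder _ h1 e
    refine ⟨F2, h2, fun y => ?_⟩
    rw [← norm_mul_FTinv_eq (hInt _ h1) (hInt _ h2) hd2,
      ← norm_mul_FTinv_eq (hInt _ h) (hInt _ h1) hd1, ← sq_abs]
    have hpi : 1 ≤ 2 * Real.pi := by linarith [Real.pi_gt_three]
    set a := |y.1 * e.1 + y.2 * e.2|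
    have h3 : 0 ≤ a ^ 2 * ‖FTinv F y‖ := by positivity
    calc a ^ 2 * ‖FTinv F y‖ ≤ (2 * Real.pi) ^ 2 * (a ^ 2 * ‖FTinv F y‖) :=
          le_mul_of_one_le_left h3 (one_le_pow₀ hpi)
      _ = _ := by ring
  obtain ⟨G1, hG1, hb1⟩ := step (1, 0) h
  obtain ⟨G2, hG2, hb2⟩ := step (0, 1) h
  obtain ⟨G3, hG3, hb3⟩ := step (0, 1) hG1
  refine ⟨(∫ ξ, ‖F ξ‖) + (∫ ξ, ‖G1 ξ‖) + (∫ ξ, ‖G2 ξ‖) + ∫ ξ, ‖G3 ξ‖, ?_, fun y => ?_⟩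
  · have : ∀ G : ℝ × ℝ → ℂ, 0 ≤ ∫ ξ, ‖G ξ‖ := fun G => integral_nonneg fun _ => norm_nonneg _
    linarith [this F, this G1, this G2, this G3]
  · have e1 := hb1 y
    have e2 := hb2 y
    have e3 := hb3 y
    simp only [mul_one, mul_zero, add_zero, zero_add] at e1 e2 e3
    have e4 : y.2 ^ 2 * (y.1 ^ 2 * ‖FTinv F y‖) ≤ y.2 ^ 2 * ‖FTinv G1 y‖ := by gcongr
    have := norm_FTinv_le F y
    have := norm_FTinv_le G1 y
    have := norm_FTinv_le G2 y
    have := norm_FTinv_le G3 y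
    nlinarith

/-- The open frequency region where the multiplier of `A_{j,0}^u` vanishes. -/
def criticalCone (b c : ℝ) : Set (ℝ × ℝ) :=
  {ξ | 100 < ‖ξ‖} ∩ ({ξ | ξ.2 ≠ 0} ∩ (fun ξ : ℝ × ℝ => ξ.1 / (c * ξ.2)) ⁻¹'
    Ioo (-(b * ((7:ℝ)/2) ^ (b-1))) (-(b * ((2:ℝ)/7) ^ (b-1))))

lemma isOpen_criticalCone {b c : ℝ} (hc : c ≠ 0) : IsOpen (criticalCone b c) := by
  refine (isOpen_lt continuous_const continuous_norm).inter ?_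
  refine ContinuousOn.isOpen_inter_preimage ?_ (isOpen_ne_fun continuous_snd continuous_const)
    isOpen_Ioo
  exact continuousOn_fst.div (continuousOn_const.mul continuousOn_snd)
    fun ξ hξ => mul_ne_zero hc hξ

lemma phaseElliptic_criticalCone {b c : ℝ} (hb : 1 < b) (hc : c ≠ 0) :
    PhaseElliptic b c (criticalCone b c) := by
  have hb0 : 0 < b := by linarith
  have hb1 : 0 < b - 1 := by linarith
  set A := b * ((2:ℝ)/7) ^ (b-1) with hA
  set B := b * ((7:ℝ)/2) ^ (b-1) with hB
  set α := b * ((1:ℝ)/2) ^ (b-1) with hα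
  set β := b * (2:ℝ) ^ (b-1) with hβ
  have hAα : A < α := mul_lt_mul_of_pos_left
    (Real.rpow_lt_rpow (by norm_num) (by norm_num) hb1) hb0
  have hβB : β < B := mul_lt_mul_of_pos_left
    (Real.rpow_lt_rpow (by norm_num) (by norm_num) hb1) hb0
  have hβ0 : 0 < β := by positivity
  set d := min (α - A) (B - β) with hd
  have hd0 : 0 < d := lt_min (by linarith) (by linarith)
  have hc0 : 0 < |c| := abs_pos.2 hc
  set K := (1 + β / d) + 1 / (|c| * d) with hK
  have hK1 : 1 ≤ K := by
    have : 0 ≤ β / d := by positivity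
    have : 0 ≤ 1 / (|c| * d) := by positivity
    linarith
  refine ⟨K⁻¹, by positivity, fun ξ hξ h100 t ht => ?_⟩
  rw [inv_mul_le_iff₀ (by linarith)]
  have ht0 : 0 < t := lt_of_lt_of_le (by norm_num) ht.1
  set s := b * t ^ (b - 1) with hs
  have hs1 : α ≤ s := mul_le_mul_of_nonneg_left
    (Real.rpow_le_rpow (by norm_num) ht.1 hb1.le) hb0.le
  have hs2 : s ≤ β := mul_le_mul_of_nonneg_left
    (Real.rpow_le_rpow ht0.le ht.2 hb1.le) hb0.le
  have hpd : phaseDeriv b c ξ t = ξ.1 + ξ.2 * (c * s) := rfl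
  rw [hpd]
  set P := |ξ.1 + ξ.2 * (c * s)| with hP
  have hP0 : 0 ≤ P := abs_nonneg _
  rw [Prod.norm_def, Real.norm_eq_abs, Real.norm_eq_abs]
  by_cases h2 : ξ.2 = 0
  · have : P = |ξ.1| := by rw [hP, h2, zero_mul, add_zero]
    rw [h2, abs_zero, max_eq_left (abs_nonneg _), ← this]
    nlinarith
  · set v := ξ.1 / (c * ξ.2) with hv
    have hcξ : c * ξ.2 ≠ 0 := mul_ne_zero hc h2
    have hvn : v ∉ Ioo (-B) (-A) := fun h => hξ ⟨h100, h2, h⟩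
    have hvs : d ≤ |v + s| := by
      by_cases h : -B < v
      · have h' : -A ≤ v := by
          by_contra h'
          exact hvn ⟨h, not_le.1 h'⟩
        exact (min_le_left _ _).trans (le_trans (by linarith) (le_abs_self _))
      · refine (min_le_right _ _).trans (le_trans ?_ (neg_le_abs _))
        linarith
    have hx1 : ξ.1 = (c * ξ.2) * v := by rw [hv]; field_simp
    have hPv : P = |c| * |ξ.2| * |v + s| := by
      rw [hP, ← abs_mul, ← abs_mul, hx1]
      congr 1
      ring
    have hx1' : |ξ.1| = |c| * |ξ.2| * |v| := by rw [hx1, abs_mul, abs_mul]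
    have hvle : |v| ≤ |v + s| * (1 + β / d) := by
      have h1 : |v| ≤ |v + s| + s := by
        have := abs_sub (v + s) s
        rw [add_sub_cancel_right, abs_of_pos (by linarith [hs1, show 0 < α by positivity] : 0 < s)]
          at this
        exact this
      have h3 : β ≤ |v + s| * (β / d) := by
        calc β = d * (β / d) := by field_simp
          _ ≤ |v + s| * (β / d) := by gcongr
      linarith
    refine max_le ?_ ?_
    · calc |ξ.1| ≤ |c| * |ξ.2| * (|v + s| * (1 + β / d)) := by rw [hx1']; gcongr
        _ = (1 + β / d) * P := by rw [hPv]; ring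
        _ ≤ K * P := by
          gcongr
          have : 0 ≤ 1 / (|c| * d) := by positivity
          linarith
    · calc |ξ.2| = 1 / (|c| * d) * (|c| * |ξ.2| * d) := by field_simp
        _ ≤ 1 / (|c| * d) * P := by rw [hPv]; gcongr
        _ ≤ K * P := by
          gcongr
          have : 0 ≤ β / d := by positivity
          linarith

lemma hasTemperateGrowth_one_add_sq_rpow (r : ℝ) :
    Function.HasTemperateGrowth fun ξ : ℝ × ℝ => (1 + (ξ.1 ^ 2 + ξ.2 ^ 2)) ^ r := by
  have h := (Function.hasTemperateGrowth_one_add_norm_sq_rpow (WithLp 2 (ℝ × ℝ)) r).comp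
    (WithLp.prodContinuousLinearEquiv 2 ℝ ℝ ℝ).symm.hasTemperateGrowth
  have heq : (fun ξ : ℝ × ℝ => (1 + (ξ.1 ^ 2 + ξ.2 ^ 2)) ^ r) =
      (fun x : WithLp 2 (ℝ × ℝ) => (1 + ‖x‖ ^ 2) ^ r) ∘
        (WithLp.prodContinuousLinearEquiv 2 ℝ ℝ ℝ).symm := by
    funext ξ
    simp [WithLp.prod_norm_sq_eq_of_L2]
  rw [heq]
  exact h

/-- Multiplying by a radial bump makes a homogeneous cutoff smooth with compact support. -/
lemma contDiff_bump_mul_homogeneous {c A : ℝ} (hc : c ≠ 0) {ς : ℝ → ℝ}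
    (hς : ContDiff ℝ (⊤ : ℕ∞) ς) (h0 : ς 0 = 0) (hA : ∀ v, A ≤ |v| → ς v = 0)
    (ρ : ContDiffBump (1:ℝ)) (hρ : ρ.rOut < 1) :
    ContDiff ℝ (⊤ : ℕ∞) fun w : ℝ × ℝ => ρ (w.1 ^ 2 + w.2 ^ 2) * ς (w.1 / (c * w.2)) := by
  refine contDiff_iff_contDiffAt.2 fun w => ?_
  by_cases h2 : w.2 = 0
  · refine (contDiffAt_const (c := (0:ℝ))).congr_of_eventuallyEq ?_
    by_cases h1 : w.1 = 0
    · have hev : ∀ᶠ z : ℝ × ℝ in 𝓝 w, z.1 ^ 2 + z.2 ^ 2 < 1 - ρ.rOut := by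
        have hcont : Continuous fun z : ℝ × ℝ => z.1 ^ 2 + z.2 ^ 2 := by fun_prop
        refine hcont.continuousAt.eventually_lt continuousAt_const ?_
        simp only [h1, h2]
        linarith
      filter_upwards [hev] with z hz
      rw [ρ.zero_of_le_dist, zero_mul]
      rw [Real.dist_eq, abs_sub_comm]
      exact le_trans (by linarith) (le_abs_self _)
    · have hev : ∀ᶠ z : ℝ × ℝ in 𝓝 w, A * |c * z.2| < |z.1| := by
        have hcont : Continuous fun z : ℝ × ℝ => A * |c * z.2| := by fun_prop
        refine hcont.continuousAt.eventually_lt continuous_fst.abs.continuousAt ?_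
        simpa [h2] using h1
      filter_upwards [hev] with z hz
      by_cases hz2 : z.2 = 0
      · simp [hz2, h0]
      · have : 0 < |c * z.2| := abs_pos.2 (mul_ne_zero hc hz2)
        rw [hA _ (by rw [abs_div, le_div_iff₀ this]; exact hz.le), mul_zero]
  · refine ContDiffAt.mul ?_ ?_
    · exact (ρ.contDiff.comp (by fun_prop : ContDiff ℝ (⊤ : ℕ∞)
        fun w : ℝ × ℝ => w.1 ^ 2 + w.2 ^ 2)).contDiffAt
    · refine hς.contDiffAt.comp w ?_
      exact contDiffAt_fst.div (contDiffAt_const.mul contDiffAt_snd) (mul_ne_zero hc h2)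

lemma hasTemperateGrowth_homogeneous_away {c A : ℝ} (hc : c ≠ 0) {ς : ℝ → ℝ}
    (hς : ContDiff ℝ (⊤ : ℕ∞) ς) (h0 : ς 0 = 0) (hA : ∀ v, A ≤ |v| → ς v = 0)
    {η : ℝ × ℝ → ℝ} (hη : Function.HasTemperateGrowth η)
    (hη1 : ∀ ξ : ℝ × ℝ, ξ.1 ^ 2 + ξ.2 ^ 2 ≤ 1 → η ξ = 1) :
    Function.HasTemperateGrowth fun ξ : ℝ × ℝ => (1 - η ξ) * ς (ξ.1 / (c * ξ.2)) := by
  let ρ : ContDiffBump (1:ℝ) := ⟨1 / 2, 3 / 4, by norm_num, by norm_num⟩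
  set k : ℝ × ℝ → ℝ := fun w => ρ (w.1 ^ 2 + w.2 ^ 2) * ς (w.1 / (c * w.2)) with hk
  have hkc : HasCompactSupport k := by
    refine HasCompactSupport.intro (isCompact_closedBall (0 : ℝ × ℝ) 2) fun w hw => ?_
    rw [hk]
    change ρ (w.1 ^ 2 + w.2 ^ 2) * _ = 0
    rw [ρ.zero_of_le_dist, zero_mul]
    rw [mem_closedBall_zero_iff, not_le, Prod.norm_def, lt_max_iff, Real.norm_eq_abs,
      Real.norm_eq_abs] at hw
    rw [Real.dist_eq]
    refine le_trans ?_ (le_abs_self _)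
    change (3:ℝ) / 4 ≤ _
    rcases hw with h | h
    · nlinarith [sq_abs w.1, sq_nonneg w.2]
    · nlinarith [sq_abs w.2, sq_nonneg w.1]
  have hkt : Function.HasTemperateGrowth k := hkc.hasTemperateGrowth
    (contDiff_bump_mul_homogeneous hc hς h0 hA ρ (by change (3:ℝ) / 4 < 1; norm_num))
  have hN := hasTemperateGrowth_one_add_sq_rpow (-(1 / 2))
  have hw : Function.HasTemperateGrowth fun ξ : ℝ × ℝ =>
      ((1 + (ξ.1 ^ 2 + ξ.2 ^ 2)) ^ (-(1 / 2) : ℝ)) • ξ := hN.fun_smul Function.HasTemperateGrowth.id'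
  have h1 := ((Function.HasTemperateGrowth.const (1:ℝ)).fun_sub hη).fun_mul (hkt.comp hw)
  refine Eq.mp (congrArg Function.HasTemperateGrowth (funext fun ξ => Eq.symm ?_)) h1
  by_cases hξ : ξ.1 ^ 2 + ξ.2 ^ 2 ≤ 1
  · rw [hη1 ξ hξ]
    simp
  · push Not at hξ
    congr 1
    set S := ξ.1 ^ 2 + ξ.2 ^ 2 with hS
    have hpos : 0 < (1 + S) ^ (-(1 / 2) : ℝ) := Real.rpow_pos_of_pos (by linarith) _
    have hsq : ((1 + S) ^ (-(1 / 2) : ℝ)) ^ 2 = (1 + S)⁻¹ := by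
      rw [← Real.rpow_natCast, ← Real.rpow_mul (by linarith)]
      norm_num [Real.rpow_neg_one]
    simp only [Function.comp_apply, hk, Prod.smul_fst, Prod.smul_snd, smul_eq_mul]
    set M := (1 + S) ^ (-(1 / 2) : ℝ)
    have e1 : (M * ξ.1) ^ 2 + (M * ξ.2) ^ 2 = S / (1 + S) := by
      rw [mul_pow, mul_pow, hsq, hS]
      field_simp
    have e2 : M * ξ.1 / (c * (M * ξ.2)) = ξ.1 / (c * ξ.2) := by
      rw [show c * (M * ξ.2) = M * (c * ξ.2) by ring, mul_div_mul_left _ _ hpos.ne']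
    rw [e1, e2, ρ.one_of_mem_closedBall, one_mul]
    rw [Metric.mem_closedBall, Real.dist_eq, abs_le]
    change -(1 / 2 : ℝ) ≤ _ ∧ _ ≤ (1 / 2 : ℝ)
    have h3 : S / (1 + S) ≤ 1 := by rw [div_le_one (by linarith)]; linarith
    have h4 : 1 / 2 ≤ S / (1 + S) := by rw [div_le_div_iff₀ (by norm_num) (by linarith)]; linarith
    constructor <;> linarith

lemma tauHat_eq_oscInt {b cp cm : ℝ} {χp : ℝ → ℝ} (h : ∀ t : ℝ, t ∉ Ioo (1/2 : ℝ) 2 → χp t = 0)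
    (ξ : ℝ × ℝ) : tauHat b cp cm χp ξ = oscInt b cp (fun t => (χp t : ℂ)) ξ := by
  unfold tauHat oscInt oscFactor
  refine integral_congr_ae (Eventually.of_forall fun t => ?_)
  by_cases ht : t ∈ Ioo (1/2 : ℝ) 2
  · simp only [curve, if_pos (show 0 < t by linarith [ht.1])]
  · simp [h t ht]

lemma oscSymbol_phiHatTau {b cp cm : ℝ} (hb : 1 < b) (hcp : cp ≠ 0)
    {χp : ℝ → ℝ} (hχsm : ContDiff ℝ (⊤ : ℕ∞) χp)
    (hχsupp : ∀ t : ℝ, t ∉ Ioo (1/2 : ℝ) 2 → χp t = 0)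
    {η : ℝ × ℝ → ℝ} (hηsm : ContDiff ℝ (⊤ : ℕ∞) η)
    (hηsupp : ∀ ξ : ℝ × ℝ, (100:ℝ)^2 < ξ.1^2 + ξ.2^2 → η ξ = 0)
    (hηone : ∀ ξ : ℝ × ℝ, ξ.1^2 + ξ.2^2 ≤ (50:ℝ)^2 → η ξ = 1)
    {ςm : ℝ → ℝ} (hςmsm : ContDiff ℝ (⊤ : ℕ∞) ςm)
    (hςmsupp : ∀ v : ℝ, v ∉ Ioo (-(b * (4:ℝ) ^ (b-1))) (-(b * (4:ℝ)⁻¹ ^ (b-1))) → ςm v = 0)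
    (hςmone : ∀ v ∈ Icc (-(b * ((7:ℝ)/2) ^ (b-1))) (-(b * ((2:ℝ)/7) ^ (b-1))), ςm v = 1) :
    OscSymbol b cp (criticalCone b cp) (phiHatTau b cp cm χp η ςm) := by
  have hb0 : 0 < b := by linarith
  have hlarge : ∀ ξ : ℝ × ℝ, 100 < ‖ξ‖ → (100:ℝ)^2 < ξ.1^2 + ξ.2^2 := by
    intro ξ hξ
    rw [Prod.norm_def, lt_max_iff, Real.norm_eq_abs, Real.norm_eq_abs] at hξ
    rcases hξ with h | h
    · nlinarith [sq_abs ξ.1, sq_nonneg ξ.2]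
    · nlinarith [sq_abs ξ.2, sq_nonneg ξ.1]
  have hηt : Function.HasTemperateGrowth η := by
    refine HasCompactSupport.hasTemperateGrowth ?_ hηsm
    refine HasCompactSupport.intro (isCompact_closedBall (0 : ℝ × ℝ) 100) fun ξ hξ => ?_
    rw [mem_closedBall_zero_iff, not_le] at hξ
    exact hηsupp ξ (hlarge ξ hξ)
  have hq : 0 < b * (4:ℝ)⁻¹ ^ (b-1) := by positivity
  have hς := hasTemperateGrowth_homogeneous_away (A := b * (4:ℝ) ^ (b-1)) hcp hςmsm
    (hςmsupp 0 fun h => by linarith [h.2])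
    (fun v hv => hςmsupp v fun h => by
      have hv0 : v < 0 := by linarith [h.2]
      rw [abs_of_neg hv0] at hv
      linarith [h.1]) hηt (fun ξ hξ => hηone ξ (hξ.trans (by norm_num)))
  have hm : Function.HasTemperateGrowth fun ξ : ℝ × ℝ =>
      ((η ξ + (1 - η ξ) * (1 - ςm (ξ.1 / (cp * ξ.2))) : ℝ) : ℂ) := by
    have h1 := Function.Complex.hasTemperateGrowth_ofReal.comp
      ((Function.HasTemperateGrowth.const (1:ℝ)).fun_sub hς)
    refine Eq.mp (congrArg Function.HasTemperateGrowth (funext fun ξ => Eq.symm ?_)) h1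
    simp only [Function.comp_apply]
    congr 1
    ring
  have hψ : IsAmplitude fun t => (χp t : ℂ) :=
    ⟨Complex.ofRealCLM.contDiff.comp hχsm, fun t ht => by
      simp [hχsupp t fun h => ht (Ioo_subset_Icc_self h)]⟩
  have : phiHatTau b cp cm χp η ςm = fun ξ => ((η ξ + (1 - η ξ) *
      (1 - ςm (ξ.1 / (cp * ξ.2))) : ℝ) : ℂ) * oscInt b cp (fun t => (χp t : ℂ)) ξ := by
    funext ξ
    rw [← tauHat_eq_oscInt (cm := cm) hχsupp]
    rfl
  rw [this]
  refine OscSymbol.mul _ _ hm ?_ hψ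
  rintro ξ ⟨h100, -, hv⟩
  rw [hηsupp ξ (hlarge ξ h100), hςmone _ (Ioo_subset_Icc_self hv)]
  simp

lemma map_dilation_volume {a d : ℝ} (ha : a ≠ 0) (hd : d ≠ 0) :
    Measure.map (fun ξ : ℝ × ℝ => (a * ξ.1, d * ξ.2)) volume =
      ENNReal.ofReal (|a⁻¹| * |d⁻¹|) • (volume : Measure (ℝ × ℝ)) := by
  have h := Measure.map_prod_map (volume : Measure ℝ) (volume : Measure ℝ)
    (measurable_const_mul a) (measurable_const_mul d)
  rw [Real.map_volume_mul_left ha, Real.map_volume_mul_left hd, Measure.prod_smul_left,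
    Measure.prod_smul_right, smul_smul, ← ENNReal.ofReal_mul (abs_nonneg _)] at h
  exact h.symm

lemma measurableEmbedding_dilation {a d : ℝ} (ha : a ≠ 0) (hd : d ≠ 0) :
    MeasurableEmbedding (fun ξ : ℝ × ℝ => (a * ξ.1, d * ξ.2)) :=
  ((Homeomorph.mulLeft₀ a ha).prodCongr (Homeomorph.mulLeft₀ d hd)).measurableEmbedding

lemma integrable_comp_dilation {F : ℝ × ℝ → ℂ} (hF : Integrable F) {a d : ℝ} (ha : a ≠ 0)
    (hd : d ≠ 0) : Integrable fun ξ : ℝ × ℝ => F (a * ξ.1, d * ξ.2) := by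
  have h := (measurableEmbedding_dilation ha hd).integrable_map_iff (μ := volume) (g := F)
  rw [map_dilation_volume ha hd] at h
  exact h.1 (hF.smul_measure ENNReal.ofReal_ne_top)

lemma integral_comp_dilation (G : ℝ × ℝ → ℂ) {a d : ℝ} (ha : a ≠ 0) (hd : d ≠ 0) :
    ∫ ξ : ℝ × ℝ, G (a * ξ.1, d * ξ.2) = (|a⁻¹| * |d⁻¹|) • ∫ ξ, G ξ := by
  have h := (measurableEmbedding_dilation ha hd).integral_map (μ := volume) G
  rw [map_dilation_volume ha hd, integral_smul_measure, ENNReal.toReal_ofReal (by positivity)] at h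
  exact h.symm

lemma FTinv_comp_dilation (F : ℝ × ℝ → ℂ) {a d : ℝ} (ha : a ≠ 0) (hd : d ≠ 0) (z : ℝ × ℝ) :
    FTinv (fun ξ => F (a * ξ.1, d * ξ.2)) z =
      (|a⁻¹| * |d⁻¹|) • FTinv F (z.1 / a, z.2 / d) := by
  unfold FTinv
  rw [← integral_comp_dilation _ ha hd]
  refine integral_congr_ae (Eventually.of_forall fun ξ => ?_)
  have : z.1 / a * (a * ξ.1) + z.2 / d * (d * ξ.2) = z.1 * ξ.1 + z.2 * ξ.2 := by field_simp
  simp only [this]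

lemma norm_FTinv_comp_dilation_le {F : ℝ × ℝ → ℂ} {C : ℝ}
    (hC : ∀ y : ℝ × ℝ, (1 + y.1 ^ 2) * (1 + y.2 ^ 2) * ‖FTinv F y‖ ≤ C) {a d : ℝ} (ha : a ≠ 0)
    (hd : d ≠ 0) (z : ℝ × ℝ) :
    ‖FTinv (fun ξ => F (a * ξ.1, d * ξ.2)) z‖ ≤ C * (poisKer |a| z.1 * poisKer |d| z.2) := by
  have key : ∀ {r : ℝ} (_ : r ≠ 0) (t : ℝ), |r⁻¹| = poisKer |r| t * (1 + (t / r) ^ 2) := by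
    intro r hr t
    have h1 : 0 < |r| := abs_pos.2 hr
    rw [poisKer, abs_inv, sq_abs]
    have h2 : r ^ 2 + t ^ 2 ≠ 0 := by positivity
    field_simp
    rw [sq_abs]
  rw [FTinv_comp_dilation F ha hd, norm_smul, Real.norm_of_nonneg (by positivity), key ha z.1,
    key hd z.2]
  have h3 : 0 ≤ poisKer |a| z.1 * poisKer |d| z.2 :=
    mul_nonneg (poisKer_nonneg (abs_nonneg _) _) (poisKer_nonneg (abs_nonneg _) _)
  calc poisKer |a| z.1 * (1 + (z.1 / a) ^ 2) * (poisKer |d| z.2 * (1 + (z.2 / d) ^ 2)) *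
        ‖FTinv F (z.1 / a, z.2 / d)‖
      = (poisKer |a| z.1 * poisKer |d| z.2) * ((1 + (z.1 / a) ^ 2) * (1 + (z.2 / d) ^ 2) *
        ‖FTinv F (z.1 / a, z.2 / d)‖) := by ring
    _ ≤ (poisKer |a| z.1 * poisKer |d| z.2) * C :=
        mul_le_mul_of_nonneg_left (hC (z.1 / a, z.2 / d)) h3
    _ = _ := mul_comm _ _

lemma FTinv_mul_FT {m g : ℝ × ℝ → ℂ} (hm : Integrable m) (hg : Integrable g) (x : ℝ × ℝ) :
    FTinv (fun ξ => m ξ * FT g ξ) x = ∫ y, g y * FTinv m (x - y) := by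
  have h1 : Integrable (Function.uncurry fun ξ y : ℝ × ℝ =>
      Complex.exp (((2 * Real.pi * ((x - y).1 * ξ.1 + (x - y).2 * ξ.2) : ℝ) : ℂ) * Complex.I) *
        (m ξ * g y)) (volume.prod volume) := by
    refine (hm.mul_prod hg).mono (AEStronglyMeasurable.mul
      (Continuous.aestronglyMeasurable ?_) (hm.mul_prod hg).1) (Eventually.of_forall fun z => ?_)
    · fun_prop
    · simp only [Function.uncurry, norm_mul, Complex.norm_exp_ofReal_mul_I, one_mul, le_refl]
  have h2 := integral_integral_swap h1
  refine Eq.trans ?_ (h2.trans ?_)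
  · unfold FTinv FT
    refine integral_congr_ae (Eventually.of_forall fun ξ => ?_)
    simp only [← integral_const_mul]
    refine integral_congr_ae (Eventually.of_forall fun y => ?_)
    have : (((2 * Real.pi * ((x - y).1 * ξ.1 + (x - y).2 * ξ.2) : ℝ) : ℂ) * Complex.I) =
        ((2 * Real.pi * (x.1 * ξ.1 + x.2 * ξ.2) : ℝ) : ℂ) * Complex.I +
        (((-(2 * Real.pi * (y.1 * ξ.1 + y.2 * ξ.2))) : ℝ) : ℂ) * Complex.I := by
      simp only [Prod.fst_sub, Prod.snd_sub]
      push_cast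
      ring
    simp only [this, Complex.exp_add]
    ring
  · refine integral_congr_ae (Eventually.of_forall fun y => ?_)
    unfold FTinv
    simp only [← integral_const_mul]
    refine integral_congr_ae (Eventually.of_forall fun ξ => ?_)
    simp only
    ring

lemma enorm_FTinv_dilation_mul_FT_le {F g : ℝ × ℝ → ℂ} (hF : Integrable F) {C : ℝ}
    (hC : ∀ y : ℝ × ℝ, (1 + y.1 ^ 2) * (1 + y.2 ^ 2) * ‖FTinv F y‖ ≤ C) (hg : Integrable g)
    (hgm : Measurable g) {a d : ℝ} (ha : a ≠ 0) (hd : d ≠ 0) (x : ℝ × ℝ) :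
    ‖FTinv (fun ξ => F (a * ξ.1, d * ξ.2) * FT g ξ) x‖ₑ ≤
      ENNReal.ofReal C * (4 * strongMax (fun y => ‖g y‖ₑ) x) := by
  have hC0 : 0 ≤ C := le_trans (by positivity) (hC 0)
  rw [FTinv_mul_FT (integrable_comp_dilation hF ha hd) hg]
  refine (enorm_integral_le_lintegral_enorm _).trans ?_
  rw [← lintegral_sub_left_eq_self _ x]
  have h1 : ∀ z : ℝ × ℝ,
      ‖g (x - z) * FTinv (fun ξ => F (a * ξ.1, d * ξ.2)) (x - (x - z))‖ₑ ≤
      ENNReal.ofReal C * (ENNReal.ofReal (poisKer |a| z.1 * poisKer |d| z.2) * ‖g (x - z)‖ₑ) := by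
    intro z
    rw [sub_sub_cancel, enorm_mul, mul_comm, ← mul_assoc, ← ENNReal.ofReal_mul hC0]
    gcongr
    rw [← ofReal_norm]
    exact ENNReal.ofReal_le_ofReal (norm_FTinv_comp_dilation_le hC ha hd z)
  refine (lintegral_mono h1).trans ?_
  rw [lintegral_const_mul' _ _ ENNReal.ofReal_ne_top]
  gcongr
  exact lintegral_poisKer_prod_le hgm.enorm x (abs_pos.2 ha) (abs_pos.2 hd)

lemma integrable_FT_schwartz (f : SchwartzMap (ℝ × ℝ) ℝ) :
    Integrable (FT fun x => ((f x : ℝ) : ℂ)) := by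
  obtain ⟨C, hC0, hC⟩ := exists_FTinv_decay
    (P := fun F => ∃ g : SchwartzMap (ℝ × ℝ) ℝ, F = fun x => ((g x : ℝ) : ℂ))
    (by rintro _ ⟨g, rfl⟩; exact g.integrable.ofReal)
    (by
      rintro _ ⟨g, rfl⟩ e
      refine ⟨_, ⟨LineDeriv.lineDerivOp e g, rfl⟩, fun ξ => ?_⟩
      have h := (g.hasFDerivAt ξ).hasLineDerivAt e
      rw [SchwartzMap.lineDerivOp_apply_eq_fderiv]
      exact HasDerivAt.ofReal_comp h)
    ⟨f, rfl⟩
  have hcont : Continuous (FT fun x => ((f x : ℝ) : ℂ)) := by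
    refine continuous_of_dominated (bound := fun x => ‖f x‖) (fun ξ => ?_) (fun ξ => ?_)
      f.integrable.norm ?_
    · refine Continuous.aestronglyMeasurable ?_
      have := f.continuous
      fun_prop
    · refine Eventually.of_forall fun x => ?_
      rw [norm_mul, Complex.norm_exp_ofReal_mul_I, one_mul, Complex.norm_real]
    · refine Eventually.of_forall fun x => ?_
      fun_prop
  have hI : Integrable (fun z : ℝ × ℝ => C * ((1 + z.1 ^ 2)⁻¹ * (1 + z.2 ^ 2)⁻¹)) :=
    (integrable_inv_one_add_sq.mul_prod integrable_inv_one_add_sq).const_mul C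
  refine hI.mono' hcont.aestronglyMeasurable (Eventually.of_forall fun ξ => ?_)
  have h1 : FT (fun x => ((f x : ℝ) : ℂ)) ξ = FTinv (fun x => ((f x : ℝ) : ℂ)) (-ξ) := by
    unfold FT FTinv
    refine integral_congr_ae (Eventually.of_forall fun x => ?_)
    simp only [Prod.fst_neg, Prod.snd_neg]
    congr 4
    ring
  have h2 := hC (-ξ)
  rw [← h1] at h2
  simp only [Prod.fst_neg, Prod.snd_neg, neg_sq] at h2
  rw [← mul_inv, ← div_eq_mul_inv, le_div_iff₀ (by positivity), mul_comm]
  exact h2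

lemma tendsto_FTinv_dilation_mul {F h : ℝ × ℝ → ℂ} (hF : Continuous F) {M : ℝ}
    (hM : ∀ ξ, ‖F ξ‖ ≤ M) (hh : Integrable h) (a : ℝ) (x : ℝ × ℝ) :
    Tendsto (fun d : ℝ => FTinv (fun ξ => F (a * ξ.1, d * ξ.2) * h ξ) x) (𝓝 0)
      (𝓝 (FTinv (fun ξ => F (a * ξ.1, 0 * ξ.2) * h ξ) x)) := by
  refine tendsto_integral_filter_of_dominated_convergence (fun ξ => M * ‖h ξ‖)
    (Eventually.of_forall fun d => ?_)
    (Eventually.of_forall fun d => Eventually.of_forall fun ξ => ?_) (hh.norm.const_mul M)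
    (Eventually.of_forall fun ξ => ?_)
  · refine (Continuous.aestronglyMeasurable ?_).mul
      ((Continuous.aestronglyMeasurable ?_).mul hh.1)
    · fun_prop
    · fun_prop
  · rw [norm_mul, norm_mul, Complex.norm_exp_ofReal_mul_I, one_mul]
    gcongr
    exact hM _
  · have : Continuous fun d : ℝ =>
        Complex.exp (((2 * Real.pi * (x.1 * ξ.1 + x.2 * ξ.2) : ℝ) : ℂ) * Complex.I) *
          (F (a * ξ.1, d * ξ.2) * h ξ) := by fun_prop
    exact this.tendsto 0

/-- The multiplier operators with dilated symbol `F` are dominated by the strong maximal function,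
uniformly in the dilation parameters, including the degenerate parameter `d = 0`. -/
lemma enorm_FTinv_dilation_mul_FT_schwartz_le {F : ℝ × ℝ → ℂ} (hF : Integrable F)
    (hFc : Continuous F) {M : ℝ} (hM : ∀ ξ, ‖F ξ‖ ≤ M) {C : ℝ}
    (hC : ∀ y : ℝ × ℝ, (1 + y.1 ^ 2) * (1 + y.2 ^ 2) * ‖FTinv F y‖ ≤ C)
    (f : SchwartzMap (ℝ × ℝ) ℝ) {a : ℝ} (ha : a ≠ 0) (d : ℝ) (x : ℝ × ℝ) :
    ‖FTinv (fun ξ => F (a * ξ.1, d * ξ.2) * FT (fun x => ((f x : ℝ) : ℂ)) ξ) x‖ₑ ≤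
      ENNReal.ofReal C * (4 * strongMax (fun y => ‖f y‖ₑ) x) := by
  have hne : ∀ d : ℝ, d ≠ 0 →
      ‖FTinv (fun ξ => F (a * ξ.1, d * ξ.2) * FT (fun x => ((f x : ℝ) : ℂ)) ξ) x‖ₑ ≤
      ENNReal.ofReal C * (4 * strongMax (fun y => ‖f y‖ₑ) x) := by
    intro d hd
    have h := enorm_FTinv_dilation_mul_FT_le hF hC (g := fun x => ((f x : ℝ) : ℂ))
      f.integrable.ofReal (Complex.continuous_ofReal.comp f.continuous).measurable ha hd x
    have he : (fun y => ‖((f y : ℝ) : ℂ)‖ₑ) = fun y => ‖f y‖ₑ := by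
      funext y
      rw [← ofReal_norm, ← ofReal_norm, Complex.norm_real]
    rwa [he] at h
  rcases eq_or_ne d 0 with rfl | hd
  · have h := (tendsto_FTinv_dilation_mul hFc hM (integrable_FT_schwartz f) a x).enorm
    exact le_of_tendsto (h.mono_left (nhdsWithin_le_nhds (s := {0}ᶜ)))
      (eventually_nhdsWithin_of_forall hne)
  · exact hne d hd

lemma lpN_le_of_le_strongMax {f : SchwartzMap (ℝ × ℝ) ℝ} {G : ℝ × ℝ → ℝ≥0∞} {C : ℝ} (hC0 : 0 ≤ C)
    (hG : ∀ x, G x ≤ ENNReal.ofReal C * (4 * strongMax (fun y => ‖f y‖ₑ) x)) {p : ℝ} (hp : 1 < p)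
    (hp2 : p ≤ 2) :
    lpN G p ≤ ENNReal.ofReal (C * 4 * 8192 ^ 2 * (p - 1) ^ (-(2:ℝ))) *
      eLpNorm ⇑f (eN p) volume := by
  have hp0 : 0 < p := by linarith
  obtain ⟨B, hB⟩ : ∃ B : ℝ, ∀ x, ‖f x‖ ≤ B := by
    obtain ⟨B, -, hB⟩ := f.decay 0 0
    exact ⟨B, fun x => by simpa using hB x⟩
  have hfm : Measurable fun y => ‖f y‖ₑ := f.continuous.measurable.enorm
  have hmax := lintegral_strongMax_rpow_le hfm (B := ENNReal.ofReal B) ENNReal.ofReal_ne_top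
    (fun t => by
      rw [← ofReal_norm]
      exact ENNReal.ofReal_le_ofReal (hB t)) hp hp2
  set Q := ENNReal.ofReal (8192 / (p - 1)) with hQ
  set A := ENNReal.ofReal C * 4 with hA
  have hA' : A ≠ ⊤ := ENNReal.mul_ne_top ENNReal.ofReal_ne_top (by simp)
  have hQ1 : 1 ≤ Q ^ 2 := by
    refine one_le_pow₀ ?_
    rw [hQ, ENNReal.one_le_ofReal, le_div_iff₀ (by linarith)]
    linarith
  have h1 : ∫⁻ x, G x ^ p ≤ A ^ p * (Q ^ 2 * ∫⁻ x, ‖f x‖ₑ ^ p) := by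
    calc ∫⁻ x, G x ^ p ≤ ∫⁻ x, A ^ p * strongMax (fun y => ‖f y‖ₑ) x ^ p := by
          refine lintegral_mono fun x => ?_
          rw [← ENNReal.mul_rpow_of_nonneg _ _ hp0.le, hA, mul_assoc]
          exact ENNReal.rpow_le_rpow (hG x) hp0.le
      _ = A ^ p * ∫⁻ x, strongMax (fun y => ‖f y‖ₑ) x ^ p :=
          lintegral_const_mul' _ _ (ENNReal.rpow_ne_top_of_nonneg hp0.le hA')
      _ ≤ _ := by gcongr
  have hinv : 0 ≤ 1 / p := by positivity
  have heL : eLpNorm ⇑f (eN p) volume = (∫⁻ x, ‖f x‖ₑ ^ p) ^ (1 / p) := by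
    rw [eLpNorm_eq_lintegral_rpow_enorm_toReal (by simpa [eN] using hp0) (by simp [eN]), eN,
      ENNReal.toReal_ofReal hp0.le]
  have hconst : ENNReal.ofReal (C * 4 * 8192 ^ 2 * (p - 1) ^ (-(2:ℝ))) = A * Q ^ 2 := by
    have h4 : (4 : ℝ≥0∞) = ENNReal.ofReal 4 := by norm_num
    rw [hA, hQ, h4, ← ENNReal.ofReal_mul hC0, ← ENNReal.ofReal_pow (by
      have : 0 < p - 1 := by linarith
      positivity), ← ENNReal.ofReal_mul (by positivity),
      Real.rpow_neg (by linarith), Real.rpow_two]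
    congr 1
    rw [div_pow]
    ring
  rw [heL, hconst, lpN]
  calc (∫⁻ x, G x ^ p) ^ (1 / p) ≤ (A ^ p * (Q ^ 2 * ∫⁻ x, ‖f x‖ₑ ^ p)) ^ (1 / p) :=
        ENNReal.rpow_le_rpow h1 hinv
    _ = A * (Q ^ 2) ^ (1 / p) * (∫⁻ x, ‖f x‖ₑ ^ p) ^ (1 / p) := by
        rw [ENNReal.mul_rpow_of_nonneg _ _ hinv, ENNReal.mul_rpow_of_nonneg _ _ hinv,
          ← ENNReal.rpow_mul, mul_one_div_cancel hp0.ne', ENNReal.rpow_one, ← mul_assoc A]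
    _ ≤ A * Q ^ 2 * (∫⁻ x, ‖f x‖ₑ ^ p) ^ (1 / p) := by
        gcongr
        calc (Q ^ 2) ^ (1 / p) ≤ (Q ^ 2) ^ (1:ℝ) := by
              refine ENNReal.rpow_le_rpow_of_exponent_le hQ1 ?_
              rw [div_le_one hp0]
              exact hp.le
          _ = Q ^ 2 := ENNReal.rpow_one _

theorem statement15 (b cp cm : ℝ) (hb : 1 < b) (hcp : cp ≠ 0) (hcm : cm ≠ 0)
    (χp : ℝ → ℝ) (hχsm : ContDiff ℝ (⊤ : ℕ∞) χp)
    (hχsupp : ∀ t : ℝ, t ∉ Ioo (1/2 : ℝ) 2 → χp t = 0)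
    (hχsum : ∀ t : ℝ, 0 < t → HasSum (fun j : ℤ => χp ((2:ℝ) ^ j * t)) 1)
    (η : ℝ × ℝ → ℝ) (hηsm : ContDiff ℝ (⊤ : ℕ∞) η)
    (hηsupp : ∀ ξ : ℝ × ℝ, (100:ℝ)^2 < ξ.1^2 + ξ.2^2 → η ξ = 0)
    (hηone : ∀ ξ : ℝ × ℝ, ξ.1^2 + ξ.2^2 ≤ (50:ℝ)^2 → η ξ = 1)
    (ςm : ℝ → ℝ) (hςmsm : ContDiff ℝ (⊤ : ℕ∞) ςm)
    (hςmsupp : ∀ v : ℝ, v ∉ Ioo (-(b * (4:ℝ) ^ (b-1))) (-(b * (4:ℝ)⁻¹ ^ (b-1))) → ςm v = 0)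
    (hςmone : ∀ v ∈ Icc (-(b * ((7:ℝ)/2) ^ (b-1))) (-(b * ((2:ℝ)/7) ^ (b-1))), ςm v = 1) :
    ∃ C : ℝ, ∀ p : ℝ, 1 < p → p ≤ 2 → ∀ f : SchwartzMap (ℝ × ℝ) ℝ,
      lpN (fun x => ⨆ (j : ℤ) (u : ℝ),
          ((‖Aj0 b cp cm χp η ςm j u ⇑f x‖₊ : ℝ≥0∞))) p
        ≤ ENNReal.ofReal (C * (p - 1) ^ (-(2:ℝ))) * eLpNorm ⇑f (eN p) volume := by
  have hO := isOpen_criticalCone (b := b) hcp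
  have hE := phaseElliptic_criticalCone hb hcp
  have hF := oscSymbol_phiHatTau (cm := cm) hb hcp hχsm hχsupp hηsm hηsupp hηone hςmsm hςmsupp
    hςmone
  obtain ⟨C, hC0, hC⟩ := exists_FTinv_decay (P := OscSymbol b cp (criticalCone b cp))
    (fun _ h => h.integrable hE) (fun _ h e => h.exists_hasLineDerivAt hO e) hF
  obtain ⟨M, hM⟩ := hF.exists_pow_mul_le hE 0
  simp only [pow_zero, one_mul] at hM
  refine ⟨C * 4 * 8192 ^ 2, fun p hp hp2 f => lpN_le_of_le_strongMax hC0 (fun x => ?_) hp hp2⟩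
  refine iSup_le fun j => iSup_le fun u => ?_
  have h := enorm_FTinv_dilation_mul_FT_schwartz_le (hF.integrable hE) hF.continuous hM hC f
    (a := (2:ℝ) ^ (-(j : ℝ))) (by positivity) ((2:ℝ) ^ (-((j : ℝ) * b)) * u) x
  simp only [mul_assoc] at h
  exact h

end
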